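/- arXiv:2506.19346 — 6 statements merged into one kernel-verified Lean document; each statement's English description precedes it below -/
import Mathlib

section
/- Suppose (p = 2 and 4 ≤ k ≤ q−3) or (p odd and 3 ≤ k ≤ q−2). Then the code RL_k(F_q^*, M) is an NMDS code with parameters [q+1, k, q+1−k] over F_q: it has dimension k, its minimum distance equals q+1−k, and the minimum distance of its dual RL_k^⊥(F_q^*, M) equals k. Moreover, the number of codewords of Hamming weight q+1−k in RL_k(F_q^*, M) equals the number of codewords of Hamming weight k in RL_k^⊥(F_q^*, M). -/
open Matrix in
lemma card_ker_eq {F : Type*} [Field F] [Fintype F] {n : ℕ} (A : Matrix (Fin n) (Fin n) F) :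
    Nat.card {x : Fin n → F // x ᵥ* A = 0} = Nat.card {x : Fin n → F // A *ᵥ x = 0} := by
  have key : ∀ B : Matrix (Fin n) (Fin n) F,
      Nat.card {x : Fin n → F // B *ᵥ x = 0} = Nat.card F ^ (n - B.rank) := by
    intro B
    have h1 : Nat.card {x : Fin n → F // B *ᵥ x = 0} = Nat.card (LinearMap.ker B.mulVecLin) :=
      Nat.card_congr (Equiv.subtypeEquivRight (by intro x; simp [LinearMap.mem_ker]))
    rw [h1, Module.natCard_eq_pow_finrank (K := F)]
    have := LinearMap.finrank_range_add_finrank_ker B.mulVecLin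
    rw [Module.finrank_fin_fun] at this
    congr 1
    unfold Matrix.rank
    omega
  rw [key, ← Matrix.rank_transpose, ← key]
  simp only [Matrix.mulVec_transpose]

open Matrix in
lemma count_fiber {F : Type*} [Field F] [Fintype F] [DecidableEq F] {k N : ℕ}
    (G : Matrix (Fin k) (Fin N) F) (S : Finset (Fin N)) (hS : S.card = k) :
    Nat.card {x : Fin k → F // ∀ j ∈ S, (x ᵥ* G) j = 0} =
      Nat.card {c : Fin N → F // G *ᵥ c = 0 ∧ ∀ j, j ∉ S → c j = 0} := by
  let e : Fin k ≃ S := (Finset.equivFinOfCardEq hS).symm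
  let A : Matrix (Fin k) (Fin k) F := G.submatrix id (fun i => (e i : Fin N))
  have h1 : Nat.card {x : Fin k → F // ∀ j ∈ S, (x ᵥ* G) j = 0} =
      Nat.card {x : Fin k → F // x ᵥ* A = 0} := by
    refine Nat.card_congr (Equiv.subtypeEquivRight ?_)
    intro x
    constructor
    · intro h
      ext i
      exact h _ (e i).2
    · intro h j hj
      have := congrFun h (e.symm ⟨j, hj⟩)
      simpa [A, Matrix.vecMul, dotProduct] using this
  rw [h1, card_ker_eq]
  have hsum : ∀ c : Fin N → F, (∀ j, j ∉ S → c j = 0) →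
      A *ᵥ (fun i => c (e i)) = G *ᵥ c := by
    intro c hc
    ext i
    simp only [Matrix.mulVec, dotProduct, A, Matrix.submatrix_apply, id]
    rw [Equiv.sum_comp e (fun j : S => G i j * c j), Finset.sum_coe_sort S (fun j => G i j * c j)]
    apply Finset.sum_subset (Finset.subset_univ _)
    intro j _ hj
    rw [hc j hj, mul_zero]
  let ext : (Fin k → F) → (Fin N → F) := fun x j => if h : j ∈ S then x (e.symm ⟨j, h⟩) else 0
  have hext0 : ∀ x j, j ∉ S → ext x j = 0 := by
    intro x j hj; simp [ext, hj]
  have hexte : ∀ x, (fun i => ext x (e i)) = x := by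
    intro x; funext i; simp [ext]
  symm
  refine Nat.card_congr
    { toFun := fun c => ⟨fun i => c.1 (e i), ?_⟩
      invFun := fun x => ⟨ext x.1, ?_, hext0 _⟩
      left_inv := ?_
      right_inv := ?_ }
  · rw [hsum _ c.2.2, c.2.1]
  · rw [← hsum _ (hext0 _), hexte, x.2]
  · intro c
    apply Subtype.ext
    funext j
    by_cases hj : j ∈ S
    · simp [ext, hj]
    · simp [ext, hj, c.2.2 j hj]
  · intro x
    apply Subtype.ext
    exact hexte _

open Matrix in
lemma count_main {F : Type*} [Field F] [Fintype F] [DecidableEq F] {k N : ℕ}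
    (G : Matrix (Fin k) (Fin N) F) (hk : 0 < k) (hkN : k < N)
    (h1 : ∀ x : Fin k → F, x ≠ 0 → N - k ≤ hammingNorm (x ᵥ* G))
    (h2 : ∀ c : Fin N → F, G *ᵥ c = 0 → c ≠ 0 → k ≤ hammingNorm c) :
    {c : Fin N → F | (∃ x : Fin k → F, c = x ᵥ* G) ∧ hammingNorm c = N - k}.ncard =
      {c : Fin N → F | G *ᵥ c = 0 ∧ hammingNorm c = k}.ncard := by
  classical
  have hinj : Function.Injective (fun x : Fin k → F => x ᵥ* G) := by
    intro x y hxy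
    by_contra hne
    have := h1 (x - y) (sub_ne_zero.mpr hne)
    rw [Matrix.sub_vecMul, sub_eq_zero.mpr hxy, hammingNorm_zero] at this
    omega
  let A : Finset (Fin k → F) := {x | hammingNorm (x ᵥ* G) = N - k}
  let B : Finset (Fin N → F) := {c | G *ᵥ c = 0 ∧ hammingNorm c = k}
  have hA : {c : Fin N → F | (∃ x : Fin k → F, c = x ᵥ* G) ∧ hammingNorm c = N - k}
      = (fun x : Fin k → F => x ᵥ* G) '' (A : Set (Fin k → F)) := by
    ext c
    simp only [Set.mem_ofPred_eq, Set.mem_image, A, Finset.coe_filter, Finset.mem_univ, true_and]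
    constructor
    · rintro ⟨⟨x, rfl⟩, h⟩; exact ⟨x, h, rfl⟩
    · rintro ⟨x, h, rfl⟩; exact ⟨⟨x, rfl⟩, h⟩
  have hB : {c : Fin N → F | G *ᵥ c = 0 ∧ hammingNorm c = k} = (B : Set (Fin N → F)) := by
    ext c; simp [B]
  rw [hA, hB, Set.ncard_image_of_injective _ hinj, Set.ncard_coe_finset, Set.ncard_coe_finset]
  let Z : (Fin k → F) → Finset (Fin N) := fun x => {j | (x ᵥ* G) j = 0}
  let W : (Fin N → F) → Finset (Fin N) := fun c => {j | c j ≠ 0}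
  have hW : ∀ c, hammingNorm c = (W c).card := fun c => rfl
  have hZ : ∀ x, (Z x).card + hammingNorm (x ᵥ* G) = N := by
    intro x
    have := Finset.card_filter_add_card_filter_not (s := (Finset.univ : Finset (Fin N)))
      (fun j => (x ᵥ* G) j = 0)
    simpa [Z, hammingNorm] using this
  rw [Finset.card_eq_sum_card_fiberwise (f := Z) (t := Finset.powersetCard k Finset.univ),
    Finset.card_eq_sum_card_fiberwise (f := W) (s := B) (t := Finset.powersetCard k Finset.univ)]
  · apply Finset.sum_congr rfl
    intro S hS
    have hS : S.card = k := (Finset.mem_powersetCard.mp hS).2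
    have e1 : A.filter (fun x => Z x = S) =
        (Finset.univ.filter (fun x : Fin k → F => ∀ j ∈ S, (x ᵥ* G) j = 0)).erase 0 := by
      ext x
      simp only [Finset.mem_filter, Finset.mem_erase, Finset.mem_univ, true_and, A]
      constructor
      · rintro ⟨hx, rfl⟩
        refine ⟨?_, fun j hj => (Finset.mem_filter.mp hj).2⟩
        rintro rfl
        simp at hx
        omega
      · rintro ⟨hx, h⟩
        have hsub : S ⊆ Z x := fun j hj => Finset.mem_filter.mpr ⟨Finset.mem_univ _, h j hj⟩
        have hc := Finset.card_le_card hsub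
        have := h1 x hx
        have := hZ x
        refine ⟨by omega, (Finset.eq_of_subset_of_card_le hsub (by omega)).symm⟩
    have e2 : B.filter (fun c => W c = S) =
        (Finset.univ.filter (fun c : Fin N → F =>
          G *ᵥ c = 0 ∧ ∀ j, j ∉ S → c j = 0)).erase 0 := by
      ext c
      simp only [Finset.mem_filter, Finset.mem_erase, Finset.mem_univ, true_and, B]
      constructor
      · rintro ⟨⟨hc, hn⟩, rfl⟩
        refine ⟨?_, hc, fun j hj => by simpa [W] using hj⟩
        rintro rfl
        simp at hn
        omega
      · rintro ⟨hne, hc, h⟩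
        have hsub : W c ⊆ S := by
          intro j hj
          by_contra hjS
          exact (Finset.mem_filter.mp hj).2 (h j hjS)
        have := Finset.card_le_card hsub
        have := h2 c hc hne
        have := hW c
        exact ⟨⟨hc, by omega⟩, Finset.eq_of_subset_of_card_le hsub (by omega)⟩
    rw [e1, e2, Finset.card_erase_of_mem (by simp), Finset.card_erase_of_mem (by simp)]
    have := count_fiber G S hS
    rw [Nat.card_eq_fintype_card, Nat.card_eq_fintype_card, Fintype.card_subtype,
      Fintype.card_subtype] at this
    rw [this]
  · intro c hc
    have hc : c ∈ B := hc
    simp only [B, Finset.mem_filter] at hc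
    simp [Finset.mem_powersetCard, ← hW, hc.2.2]
  · intro x hx
    have hx : x ∈ A := hx
    simp only [A, Finset.mem_filter] at hx
    have := hZ x
    rw [Finset.mem_coe, Finset.mem_powersetCard]
    exact ⟨Finset.subset_univ _, by omega⟩

lemma subset_sum_small {F : Type*} [Field F] [Fintype F] [DecidableEq F] (n : ℕ) (s : F)
    (hn : 2 * n ≤ Fintype.card F)
    (h : ((2 : F) ≠ 0 ∧ 2 ≤ n) ∨ ((2 : F) = 0 ∧ 3 ≤ n)) :
    ∃ T : Finset F, T.card = n ∧ (0 : F) ∉ T ∧ ∑ b ∈ T, b = s := by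
  have hT : ∃ T : Finset F, T.card = n - 2 ∧ (0 : F) ∉ T ∧ ((2 : F) ≠ 0 ∨ ∑ b ∈ T, b ≠ s) := by
    rcases h with ⟨h2, h⟩ | ⟨h2, h⟩
    · obtain ⟨T, hT, hc⟩ := Finset.exists_subset_card_eq (s := (Finset.univ.erase (0 : F)))
        (n := n - 2) (by rw [Finset.card_erase_of_mem (Finset.mem_univ _), Finset.card_univ]; omega)
      exact ⟨T, hc, fun h0 => by simpa using hT h0, Or.inl h2⟩
    · obtain ⟨T, hT, hc⟩ := Finset.exists_subset_card_eq (s := (Finset.univ.erase (0 : F)))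
        (n := n - 3) (by rw [Finset.card_erase_of_mem (Finset.mem_univ _), Finset.card_univ]; omega)
      have h0 : (0 : F) ∉ T := fun h0 => by simpa using hT h0
      have hlt : (insert (s - ∑ b ∈ T, b) (insert 0 T)).card < (Finset.univ : Finset F).card := by
        have a1 := Finset.card_insert_le (s - ∑ b ∈ T, b) (insert 0 T)
        have a2 := Finset.card_insert_le 0 T
        rw [Finset.card_univ]
        omega
      obtain ⟨y, -, hy⟩ := Finset.exists_mem_notMem_of_card_lt_card hlt
      simp only [Finset.mem_insert, not_or] at hy
      refine ⟨insert y T, ?_, ?_, Or.inr ?_⟩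
      · rw [Finset.card_insert_of_notMem hy.2.2]; omega
      · simp only [Finset.mem_insert, not_or]; exact ⟨fun h => hy.2.1 h.symm, h0⟩
      · rw [Finset.sum_insert hy.2.2]
        intro h; exact hy.1 (by rw [← h]; ring)
  obtain ⟨T, hc, h0, hor⟩ := hT
  set r := s - ∑ b ∈ T, b with hr
  let D : Finset F := Finset.univ.filter (fun b => 2 * b = r)
  have hD : D.card ≤ 1 := by
    rw [Finset.card_le_one]
    intro x hx y hy
    simp only [D, Finset.mem_filter, Finset.mem_univ, true_and] at hx hy
    rcases hor with h2 | h2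
    · exact mul_left_cancel₀ h2 (hx.trans hy.symm)
    · by_cases h3 : (2 : F) = 0
      · rw [h3, zero_mul] at hx
        exact absurd (sub_eq_zero.mp hx.symm).symm h2
      · exact mul_left_cancel₀ h3 (hx.trans hy.symm)
  let U := insert 0 T
  have hU : U.card = n - 1 := by
    simp only [U]
    rw [Finset.card_insert_of_notMem h0]; omega
  have hlt : (U ∪ U.image (fun b => r - b) ∪ D).card < (Finset.univ : Finset F).card := by
    have a1 := Finset.card_union_le (U ∪ U.image (fun b => r - b)) D
    have a2 := Finset.card_union_le U (U.image (fun b => r - b))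
    have a3 := Finset.card_image_le (s := U) (f := (fun b => r - b))
    rw [Finset.card_univ]
    omega
  obtain ⟨y, -, hy⟩ := Finset.exists_mem_notMem_of_card_lt_card hlt
  simp only [Finset.mem_union, not_or] at hy
  obtain ⟨⟨hy1, hy2⟩, hy3⟩ := hy
  have hy4 : r - y ∉ U := fun h => hy2 (Finset.mem_image.mpr ⟨r - y, h, by ring⟩)
  have hy5 : 2 * y ≠ r := fun h => hy3 (by simp [D, h])
  simp only [U, Finset.mem_insert, not_or] at hy1 hy4
  have hm : y ∉ insert (r - y) T := by
    simp only [Finset.mem_insert, not_or]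
    exact ⟨fun h => hy5 (by linear_combination h), hy1.2⟩
  refine ⟨insert y (insert (r - y) T), ?_, ?_, ?_⟩
  · rw [Finset.card_insert_of_notMem hm, Finset.card_insert_of_notMem hy4.2]; omega
  · simp only [Finset.mem_insert, not_or]
    exact ⟨fun h => hy1.1 h.symm, fun h => hy4.1 h.symm, h0⟩
  · rw [Finset.sum_insert hm, Finset.sum_insert hy4.2, hr]; ring

lemma subset_sum {F : Type*} [Field F] [Fintype F] [DecidableEq F] (n : ℕ) (s : F)
    (h : ((2 : F) ≠ 0 ∧ 2 ≤ n ∧ n + 3 ≤ Fintype.card F) ∨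
      ((2 : F) = 0 ∧ 3 ≤ n ∧ n + 4 ≤ Fintype.card F)) :
    ∃ T : Finset F, T.card = n ∧ (0 : F) ∉ T ∧ ∑ b ∈ T, b = s := by
  by_cases hn : 2 * n ≤ Fintype.card F
  · apply subset_sum_small n s hn
    rcases h with h | h
    · exact Or.inl ⟨h.1, h.2.1⟩
    · exact Or.inr ⟨h.1, h.2.1⟩
  · obtain ⟨T, hc, h0, hs⟩ := subset_sum_small (Fintype.card F - 1 - n) (-s) (by omega) (by
      rcases h with h | h
      · exact Or.inl ⟨h.1, by omega⟩
      · exact Or.inr ⟨h.1, by omega⟩)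
    have hm : (0 : F) ∈ Tᶜ := by simpa using h0
    refine ⟨Tᶜ.erase 0, ?_, by simp, ?_⟩
    · rw [Finset.card_erase_of_mem hm, Finset.card_compl]; omega
    · have h1 : ∑ x : F, x = 0 := by
        have := FiniteField.sum_pow_lt_card_sub_one F 1 (by omega)
        simpa using this
      have h2 := Finset.sum_add_sum_compl T (fun x : F => x)
      have h3 := Finset.sum_erase (s := Tᶜ) (f := fun x : F => x) (a := 0) rfl
      rw [h3]
      rw [h1, hs] at h2
      linear_combination h2


/-- RL_k(F_q^*, M) is NMDS with parameters [q+1, k, q+1-k]: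
dimension k, minimum distance q+1-k, dual minimum distance k, and the number of
minimum-weight codewords of the code equals that of its dual. -/
theorem stmt10 (p m q k : ℕ) (hp : p.Prime) (hm : 0 < m) (hq : q = p ^ m)
    (F : Type*) [Field F] [Fintype F] [DecidableEq F] (hF : Fintype.card F = q)
    (hrange : (p = 2 ∧ 4 ≤ k ∧ k ≤ q - 3) ∨ (Odd p ∧ 3 ≤ k ∧ k ≤ q - 2))
    (β : Fin (q - 1) → F) (hβinj : Function.Injective β)
    (hβrange : Set.range β = {x : F | x ≠ 0})
    (a : Matrix (Fin 2) (Fin 2) F) (ha : IsUnit a.det)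
    (G₁ : Matrix (Fin k) (Fin (q + 1)) F)
    (hGv : ∀ (i : Fin k) (j : Fin (q + 1)) (h : (j : ℕ) < q - 1),
      G₁ i j = β ⟨j, h⟩ ^ (i : ℕ))
    (hGc1 : ∀ (i : Fin k) (j : Fin (q + 1)), (j : ℕ) = q - 1 →
      G₁ i j = if (i : ℕ) = k - 2 then a 0 0 else if (i : ℕ) = k - 1 then a 1 0 else 0)
    (hGc2 : ∀ (i : Fin k) (j : Fin (q + 1)), (j : ℕ) = q →
      G₁ i j = if (i : ℕ) = k - 2 then a 0 1 else if (i : ℕ) = k - 1 then a 1 1 else 0) :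
    -- the code has dimension k
    Module.finrank F (LinearMap.range G₁.vecMulLinear) = k ∧
    -- the minimum distance of the code is q + 1 - k
    ((∃ c : Fin (q + 1) → F, (∃ x : Fin k → F, c = Matrix.vecMul x G₁) ∧
        c ≠ 0 ∧ hammingNorm c = q + 1 - k) ∧
      (∀ c : Fin (q + 1) → F, (∃ x : Fin k → F, c = Matrix.vecMul x G₁) →
        c ≠ 0 → q + 1 - k ≤ hammingNorm c)) ∧
    -- the minimum distance of the dual code is k
    ((∃ c : Fin (q + 1) → F,
        (∀ y : Fin (q + 1) → F, (∃ x : Fin k → F, y = Matrix.vecMul x G₁) →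
          ∑ i, c i * y i = 0) ∧ c ≠ 0 ∧ hammingNorm c = k) ∧
      (∀ c : Fin (q + 1) → F,
        (∀ y : Fin (q + 1) → F, (∃ x : Fin k → F, y = Matrix.vecMul x G₁) →
          ∑ i, c i * y i = 0) → c ≠ 0 → k ≤ hammingNorm c)) ∧
    -- A_{q+1-k} = A_k^⊥
    {c : Fin (q + 1) → F | (∃ x : Fin k → F, c = Matrix.vecMul x G₁) ∧
        hammingNorm c = q + 1 - k}.ncard =
      {c : Fin (q + 1) → F |
        (∀ y : Fin (q + 1) → F, (∃ x : Fin k → F, y = Matrix.vecMul x G₁) →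
          ∑ i, c i * y i = 0) ∧ hammingNorm c = k}.ncard := by
  have hk3 : 3 ≤ k := by rcases hrange with h | h <;> omega
  have hkq : k + 2 ≤ q := by rcases hrange with h | h <;> omega
  -- the point attached to a coordinate
  let b : Fin (q + 1) → F := fun j => if h : (j : ℕ) < q - 1 then β ⟨j, h⟩ else 0
  let j1 : Fin (q + 1) := ⟨q - 1, by omega⟩
  let j2 : Fin (q + 1) := ⟨q, by omega⟩
  have hbinj : ∀ i j : Fin (q + 1), (i : ℕ) < q - 1 → (j : ℕ) < q - 1 → b i = b j → i = j := by
    intro i j hi hj h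
    simp only [b, hi, hj, dif_pos] at h
    have := hβinj h
    rw [Fin.mk.injEq] at this
    exact Fin.ext this
  have hbsurj : ∀ y : F, y ≠ 0 → ∃ j : Fin (q + 1), (j : ℕ) < q - 1 ∧ b j = y := by
    intro y hy
    have : y ∈ Set.range β := by rw [hβrange]; exact hy
    obtain ⟨i, rfl⟩ := this
    refine ⟨⟨i, by omega⟩, i.2, ?_⟩
    simp [b]
  have hcases : ∀ j : Fin (q + 1), (j : ℕ) < q - 1 ∨ j = j1 ∨ j = j2 := by
    intro j
    simp only [Fin.ext_iff, j1, j2]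
    omega
  -- codewords as evaluations
  have hev : ∀ f : Polynomial F, f.natDegree < k → ∀ j : Fin (q + 1), (j : ℕ) < q - 1 →
      Matrix.vecMul (fun i : Fin k => f.coeff i) G₁ j = f.eval (b j) := by
    intro f hf j hj
    rw [Polynomial.eval_eq_sum_range' hf, Finset.sum_range]
    simp only [Matrix.vecMul, dotProduct]
    apply Finset.sum_congr rfl
    intro i _
    rw [hGv i j hj]
    simp [b, hj]
  have hlast : ∀ (u v : F) (x : ℕ → F), ∑ i : Fin k, x i *
      (if (i : ℕ) = k - 2 then u else if (i : ℕ) = k - 1 then v else 0)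
        = x (k - 2) * u + x (k - 1) * v := by
    intro u v x
    rw [← Finset.sum_range (fun i => x i *
      (if i = k - 2 then u else if i = k - 1 then v else 0))]
    obtain ⟨l, rfl⟩ : ∃ l, k = l + 2 := ⟨k - 2, by omega⟩
    rw [Finset.sum_range_succ, Finset.sum_range_succ, Finset.sum_eq_zero]
    · simp
    · intro i hi
      have := Finset.mem_range.mp hi
      rw [if_neg (by omega), if_neg (by omega), mul_zero]
  have hc1 : ∀ f : Polynomial F, Matrix.vecMul (fun i : Fin k => f.coeff i) G₁ j1 =
      f.coeff (k - 2) * a 0 0 + f.coeff (k - 1) * a 1 0 := by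
    intro f
    rw [← hlast]
    simp only [Matrix.vecMul, dotProduct]
    exact Finset.sum_congr rfl fun i _ => by rw [hGc1 i j1 rfl]
  have hc2 : ∀ f : Polynomial F, Matrix.vecMul (fun i : Fin k => f.coeff i) G₁ j2 =
      f.coeff (k - 2) * a 0 1 + f.coeff (k - 1) * a 1 1 := by
    intro f
    rw [← hlast]
    simp only [Matrix.vecMul, dotProduct]
    exact Finset.sum_congr rfl fun i _ => by rw [hGc2 i j2 rfl]
  have hdet : a 0 0 * a 1 1 - a 0 1 * a 1 0 ≠ 0 := by
    rw [← Matrix.det_fin_two]; exact ha.ne_zero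
  have hZ : ∀ c : Fin (q + 1) → F,
      (Finset.univ.filter (fun j => c j = 0)).card + hammingNorm c = q + 1 := by
    intro c
    have := Finset.card_filter_add_card_filter_not (s := (Finset.univ : Finset (Fin (q + 1))))
      (fun j => c j = 0)
    simpa [hammingNorm] using this
  -- lower bound for the code
  have h1 : ∀ x : Fin k → F, x ≠ 0 → q + 1 - k ≤ hammingNorm (Matrix.vecMul x G₁) := by
    intro x hx
    obtain ⟨f, hfd, hfx⟩ : ∃ f : Polynomial F, f.natDegree < k ∧
        x = fun i : Fin k => f.coeff i := by
      refine ⟨Polynomial.ofFn k x, Polynomial.ofFn_natDegree_lt (by omega) x, ?_⟩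
      funext i
      rw [Polynomial.ofFn_coeff_eq_val_of_lt x i.2]
    have hf0 : f ≠ 0 := by
      rintro rfl
      apply hx
      rw [hfx]
      funext i
      simp
    subst hfx
    set c := Matrix.vecMul (fun i : Fin k => f.coeff i) G₁ with hc
    let Zv : Finset (Fin (q + 1)) := Finset.univ.filter (fun j => (j : ℕ) < q - 1 ∧ c j = 0)
    have hZv : Zv.card ≤ f.natDegree := by
      have e1 : Zv.card ≤ f.roots.toFinset.card := by
        apply Finset.card_le_card_of_injOn b
        · intro j hj
          have hj : (j : ℕ) < q - 1 ∧ c j = 0 := by simpa [Zv] using hj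
          rw [Finset.mem_coe, Multiset.mem_toFinset, Polynomial.mem_roots hf0, Polynomial.IsRoot,
            ← hev f hfd j hj.1]
          exact hj.2
        · intro i hi j hj hij
          have hi : (i : ℕ) < q - 1 ∧ c i = 0 := by simpa [Zv] using hi
          have hj : (j : ℕ) < q - 1 ∧ c j = 0 := by simpa [Zv] using hj
          exact hbinj i j hi.1 hj.1 hij
      exact e1.trans ((Multiset.toFinset_card_le _).trans (Polynomial.card_roots' f))
    have hZc := hZ c
    have hsubset : ∀ S : Finset (Fin (q + 1)), (c j1 = 0 → j1 ∈ S) → (c j2 = 0 → j2 ∈ S) →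
        (Finset.univ.filter (fun j => c j = 0)).card ≤ Zv.card + S.card := by
      intro S hS1 hS2
      refine (Finset.card_le_card (t := Zv ∪ S) ?_).trans (Finset.card_union_le _ _)
      intro j hj
      have hj : c j = 0 := by simpa using hj
      rw [Finset.mem_union]
      rcases hcases j with h | rfl | rfl
      · left; simp [Zv, h, hj]
      · exact Or.inr (hS1 hj)
      · exact Or.inr (hS2 hj)
    by_cases hj1 : c j1 = 0
    · by_cases hj2 : c j2 = 0
      · have e1 := hc1 f
        have e2 := hc2 f
        rw [← hc, hj1] at e1
        rw [← hc, hj2] at e2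
        have z1 : f.coeff (k - 2) = 0 := by
          have : (a 0 0 * a 1 1 - a 0 1 * a 1 0) * f.coeff (k - 2) = 0 := by
            linear_combination a 1 0 * e2 - a 1 1 * e1
          exact (mul_eq_zero.mp this).resolve_left hdet
        have z2 : f.coeff (k - 1) = 0 := by
          have : (a 0 0 * a 1 1 - a 0 1 * a 1 0) * f.coeff (k - 1) = 0 := by
            linear_combination a 0 1 * e1 - a 0 0 * e2
          exact (mul_eq_zero.mp this).resolve_left hdet
        have hdeg : f.natDegree ≤ k - 3 := by
          rw [Polynomial.natDegree_le_iff_coeff_eq_zero]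
          intro n hn
          by_cases n1 : n = k - 2
          · rw [n1, z1]
          · by_cases n2 : n = k - 1
            · rw [n2, z2]
            · exact Polynomial.coeff_eq_zero_of_natDegree_lt (by omega)
        have := hsubset {j1, j2} (by simp) (by simp)
        have := Finset.card_le_two (a := j1) (b := j2)
        omega
      · have := hsubset {j1} (by simp) (fun h => absurd h hj2)
        rw [Finset.card_singleton] at this
        omega
    · have := hsubset {j2} (fun h => absurd h hj1) (by simp)
      rw [Finset.card_singleton] at this
      omega
  -- the dual condition
  have hdual : ∀ c : Fin (q + 1) → F, (∀ y : Fin (q + 1) → F,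
      (∃ x : Fin k → F, y = Matrix.vecMul x G₁) → ∑ i, c i * y i = 0) ↔
      Matrix.mulVec G₁ c = 0 := by
    intro c
    constructor
    · intro h
      rw [← dotProduct_eq_zero_iff]
      intro w
      rw [dotProduct_comm, Matrix.dotProduct_mulVec, dotProduct_comm]
      exact h _ ⟨w, rfl⟩
    · rintro h y ⟨x, rfl⟩
      change c ⬝ᵥ _ = 0
      rw [dotProduct_comm, ← Matrix.dotProduct_mulVec, h, dotProduct_zero]
  -- lower bound for the dual
  have h2 : ∀ c : Fin (q + 1) → F, Matrix.mulVec G₁ c = 0 → c ≠ 0 → k ≤ hammingNorm c := by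
    intro c hc hne
    by_contra hlt
    push Not at hlt
    have hort : ∀ f : Polynomial F,
        ∑ i, c i * Matrix.vecMul (fun i : Fin k => f.coeff i) G₁ i = 0 := fun f =>
      (hdual c).mpr hc _ ⟨_, rfl⟩
    let T : Finset (Fin (q + 1)) := Finset.univ.filter (fun j => (j : ℕ) < q - 1 ∧ c j ≠ 0)
    have hTle : ∀ j : Fin (q + 1), ¬ (j : ℕ) < q - 1 → c j ≠ 0 → T.card + 2 ≤ k := by
      intro j hj hcj
      have : (insert j T).card ≤ hammingNorm c := by
        apply Finset.card_le_card
        intro i hi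
        rcases Finset.mem_insert.mp hi with rfl | hi
        · simpa using hcj
        · simp only [T, Finset.mem_filter] at hi
          simpa using hi.2.2
      rw [Finset.card_insert_of_notMem (by simp [T, hj])] at this
      omega
    have hTk : T.card ≤ hammingNorm c := by
      apply Finset.card_le_card
      intro i hi
      simp only [T, Finset.mem_filter] at hi
      simpa using hi.2.2
    have hV : ∀ j : Fin (q + 1), (j : ℕ) < q - 1 → c j = 0 := by
      intro j hj
      by_contra hcj
      have hjT : j ∈ T := by simp [T, hj, hcj]
      let f : Polynomial F := ∏ i ∈ T.erase j, (Polynomial.X - Polynomial.C (b i))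
      have hfd : f.natDegree = T.card - 1 := by
        simp only [f]
        rw [Polynomial.natDegree_finsetProd_X_sub_C_eq_card, Finset.card_erase_of_mem hjT]
      have hTpos : 0 < T.card := Finset.card_pos.mpr ⟨j, hjT⟩
      have hfk : f.natDegree < k := by omega
      have hcoef : T.card + 2 ≤ k → f.coeff (k - 2) = 0 ∧ f.coeff (k - 1) = 0 := fun h =>
        ⟨Polynomial.coeff_eq_zero_of_natDegree_lt (by omega),
          Polynomial.coeff_eq_zero_of_natDegree_lt (by omega)⟩
      have hs := hort f
      rw [Finset.sum_eq_single j] at hs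
      · rw [hev f hfk j hj] at hs
        have := (mul_eq_zero.mp hs).resolve_left hcj
        simp only [f, Polynomial.eval_prod, Finset.prod_eq_zero_iff] at this
        obtain ⟨i, hi, h0⟩ := this
        rw [Finset.mem_erase] at hi
        have hiV : (i : ℕ) < q - 1 := (Finset.mem_filter.mp hi.2).2.1
        apply hi.1
        apply hbinj i j hiV hj
        simp only [Polynomial.eval_sub, Polynomial.eval_X, Polynomial.eval_C] at h0
        exact (sub_eq_zero.mp h0).symm
      · intro i _ hij
        by_cases hci : c i = 0
        · rw [hci, zero_mul]
        · rcases hcases i with h | rfl | rfl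
          · rw [hev f hfk i h]
            have : f.eval (b i) = 0 := by
              simp only [f, Polynomial.eval_prod]
              apply Finset.prod_eq_zero (i := i)
              · rw [Finset.mem_erase]; exact ⟨hij, by simp [T, h, hci]⟩
              · simp
            rw [this, mul_zero]
          · obtain ⟨z1, z2⟩ := hcoef (hTle j1 (by simp [j1]) hci)
            rw [hc1, z1, z2]; ring
          · obtain ⟨z1, z2⟩ := hcoef (hTle j2 (by simp [j2]) hci)
            rw [hc2, z1, z2]; ring
      · intro h; exact absurd (Finset.mem_univ _) h
    have hj12 : j1 ≠ j2 := by
      simp only [ne_eq, Fin.ext_iff, j1, j2]; omega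
    have hsum : ∀ f : Polynomial F,
        c j1 * (f.coeff (k - 2) * a 0 0 + f.coeff (k - 1) * a 1 0) +
        c j2 * (f.coeff (k - 2) * a 0 1 + f.coeff (k - 1) * a 1 1) = 0 := by
      intro f
      have := hort f
      rw [← Finset.sum_subset (Finset.subset_univ {j1, j2}), Finset.sum_pair hj12, hc1, hc2] at this
      · exact this
      · intro i _ hi
        rw [hV i ?_, zero_mul]
        rcases hcases i with h | rfl | rfl
        · exact h
        · simp at hi
        · simp at hi
    have s1 := hsum (Polynomial.X ^ (k - 2))
    have s2 := hsum (Polynomial.X ^ (k - 1))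
    simp only [Polynomial.coeff_X_pow] at s1 s2
    have n1 : ¬ (k - 1 = k - 2) := by omega
    have n2 : ¬ (k - 2 = k - 1) := by omega
    simp only [n1, n2, if_true, if_false] at s1 s2
    apply hne
    funext j
    rcases hcases j with h | rfl | rfl
    · exact hV j h
    · have : (a 0 0 * a 1 1 - a 0 1 * a 1 0) * c j1 = 0 := by
        linear_combination a 1 1 * s1 - a 0 1 * s2
      exact (mul_eq_zero.mp this).resolve_left hdet
    · have : (a 0 0 * a 1 1 - a 0 1 * a 1 0) * c j2 = 0 := by
        linear_combination a 0 0 * s2 - a 1 0 * s1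
      exact (mul_eq_zero.mp this).resolve_left hdet
  have hinj : Function.Injective G₁.vecMulLinear := by
    rw [injective_iff_map_eq_zero]
    intro x hx
    by_contra hne
    have := h1 x hne
    rw [Matrix.vecMulLinear_apply] at hx
    rw [hx, hammingNorm_zero] at this
    omega
  -- existence of a codeword of weight q + 1 - k
  have hsub : ∀ s : F, ∃ T : Finset F, T.card = k - 1 ∧ (0 : F) ∉ T ∧ ∑ y ∈ T, y = s := by
    intro s
    apply subset_sum
    haveI : Fact p.Prime := ⟨hp⟩
    haveI : CharP F p := charP_of_card_eq_prime_pow (f := m) (by rw [hF, hq])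
    have h2p := CharP.cast_eq_zero_iff F p 2
    rw [Nat.cast_ofNat] at h2p
    rcases hrange with ⟨hp2, h4, h5⟩ | ⟨hp2, h4, h5⟩
    · right
      exact ⟨h2p.mpr (by rw [hp2]), by omega, by omega⟩
    · left
      refine ⟨fun h => ?_, by omega, by omega⟩
      have := (Nat.prime_dvd_prime_iff_eq hp Nat.prime_two).mp (h2p.mp h)
      rw [this] at hp2
      exact absurd hp2 (by decide)
  have hex : ∃ x : Fin k → F, x ≠ 0 ∧ hammingNorm (Matrix.vecMul x G₁) = q + 1 - k := by
    have hgen : ∀ (j' : Fin (q + 1)) (u v : F), ¬ (j' : ℕ) < q - 1 → u ≠ 0 →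
        (∀ f : Polynomial F, Matrix.vecMul (fun i : Fin k => f.coeff i) G₁ j' =
          f.coeff (k - 2) * u + f.coeff (k - 1) * v) →
        ∃ x : Fin k → F, x ≠ 0 ∧ hammingNorm (Matrix.vecMul x G₁) = q + 1 - k := by
      intro j' u v hj' hu hw
      obtain ⟨T, hTc, hT0, hTs⟩ := hsub (v / u)
      let f : Polynomial F := ∏ y ∈ T, (Polynomial.X - Polynomial.C y)
      have hfd : f.natDegree = k - 1 := by
        have := Polynomial.natDegree_finsetProd_X_sub_C_eq_card T (fun y : F => y)
        rw [hTc] at this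
        exact this
      have hfk1 : f.coeff (k - 1) = 1 := by
        have hm : f.Monic := Polynomial.monic_prod_of_monic _ _ fun y _ => Polynomial.monic_X_sub_C y
        have := hm.coeff_natDegree
        rwa [hfd] at this
      have hfk2 : f.coeff (k - 2) = -(v / u) := by
        have := Polynomial.prod_X_sub_C_coeff_card_pred T (fun y : F => y) (by omega)
        rw [hTc, hTs, show k - 1 - 1 = k - 2 by omega] at this
        exact this
      have hx0 : (fun i : Fin k => f.coeff i) ≠ 0 := by
        intro h
        have := congrFun h ⟨k - 1, by omega⟩
        simp only [hfk1] at this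
        exact one_ne_zero this
      refine ⟨fun i : Fin k => f.coeff i, hx0, ?_⟩
      have hlow := h1 _ hx0
      set c := Matrix.vecMul (fun i : Fin k => f.coeff i) G₁ with hc
      have hZc := hZ c
      let Tv : Finset (Fin (q + 1)) := Finset.univ.filter (fun j => (j : ℕ) < q - 1 ∧ b j ∈ T)
      have hTv : T.card ≤ Tv.card := by
        refine (Finset.card_le_card (t := Tv.image b) ?_).trans Finset.card_image_le
        intro y hy
        obtain ⟨j, hj, rfl⟩ := hbsurj y (fun h => hT0 (h ▸ hy))
        exact Finset.mem_image_of_mem _ (by simp [Tv, hj, hy])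
      have hle : (insert j' Tv).card ≤ (Finset.univ.filter (fun j => c j = 0)).card := by
        apply Finset.card_le_card
        intro j hj
        rw [Finset.mem_filter]
        refine ⟨Finset.mem_univ _, ?_⟩
        rcases Finset.mem_insert.mp hj with rfl | hj
        · rw [hc, hw, hfk1, hfk2]
          field_simp
          ring
        · have hj : (j : ℕ) < q - 1 ∧ b j ∈ T := by simpa [Tv] using hj
          rw [hc, hev f (by omega) j hj.1]
          simp only [f, Polynomial.eval_prod]
          exact Finset.prod_eq_zero hj.2 (by simp)
      rw [Finset.card_insert_of_notMem (by simp [Tv, hj'])] at hle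
      omega
    by_cases h00 : a 0 0 = 0
    · refine hgen j2 (a 0 1) (a 1 1) (by simp [j2]) ?_ hc2
      intro h01
      apply hdet
      rw [h00, h01]; ring
    · exact hgen j1 (a 0 0) (a 1 0) (by simp [j1]) h00 hc1
  have hcount := count_main G₁ (by omega) (by omega) h1 h2
  obtain ⟨x, hx0, hxn⟩ := hex
  have hne0 : ∀ (c : Fin (q + 1) → F) (n : ℕ), 0 < n → hammingNorm c = n → c ≠ 0 := by
    rintro c n hn h rfl
    rw [hammingNorm_zero] at h
    omega
  simp only [hdual]
  refine ⟨?_, ⟨⟨_, ⟨x, rfl⟩, hne0 _ _ (by omega) hxn, hxn⟩, ?_⟩, ⟨?_, h2⟩, hcount⟩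
  · rw [LinearMap.finrank_range_of_inj hinj, Module.finrank_fin_fun]
  · rintro c ⟨y, rfl⟩ hc
    apply h1
    rintro rfl
    exact hc (Matrix.zero_vecMul _)
  · have hpos : 0 < {c : Fin (q + 1) → F | Matrix.mulVec G₁ c = 0 ∧ hammingNorm c = k}.ncard := by
      rw [← hcount, Set.ncard_pos (Set.toFinite _)]
      exact ⟨_, ⟨x, rfl⟩, hxn⟩
    obtain ⟨c, hc, hn⟩ := (Set.ncard_pos (Set.toFinite _)).mp hpos
    exact ⟨c, hc, hne0 c k (by omega) hn, hn⟩
end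

section
/- Suppose (p = 2 and 4 ≤ k ≤ q−2) or (p odd and 3 ≤ k ≤ q), and suppose p does not divide k−1. Then the minimum distance of RL_k^⊥(F_q, M) equals k, and the number of codewords of Hamming weight exactly k in RL_k^⊥(F_q, M) equals (2(q−1)/q)·C(q, k−1) if a_{11} ≠ 0 and a_{12} ≠ 0, and equals ((q−1)/q)·C(q, k−1) if exactly one of a_{11}, a_{12} is zero (note that a_{11} = a_{12} = 0 is impossible since M is invertible); here C(·,·) denotes the binomial coefficient. -/
def RLmom {F : Type*} [Field F] [Fintype F] (f : F → F) (i : ℕ) : F := ∑ x, f x * x ^ i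

def RLsupp {F : Type*} [Field F] [Fintype F] [DecidableEq F] (f : F → F) : Finset F :=
  Finset.univ.filter (fun x => f x ≠ 0)

section core
open Polynomial
variable {F : Type*} [Field F] [Fintype F] [DecidableEq F]

theorem RL_mom_poly (f : F → F) (P : F[X]) (n : ℕ) (h : P.natDegree < n) :
    ∑ x, f x * P.eval x = ∑ i ∈ Finset.range n, P.coeff i * RLmom f i := by
  simp_rw [Polynomial.eval_eq_sum_range' h, RLmom, Finset.mul_sum]
  rw [Finset.sum_comm]
  refine Finset.sum_congr rfl fun i _ => Finset.sum_congr rfl fun x _ => by ring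

theorem RL_zero (f : F → F) (n : ℕ) (h : ∀ i < n, RLmom f i = 0)
    (hs : (RLsupp f).card ≤ n) : f = 0 := by
  by_contra hne
  obtain ⟨x0, hx0⟩ := Function.ne_iff.1 hne
  have hx0' : f x0 ≠ 0 := hx0
  have hmem : x0 ∈ RLsupp f := by simp [RLsupp, hx0']
  set P : F[X] := ∏ y ∈ (RLsupp f).erase x0, (X - C y) with hP
  have hdeg : P.natDegree < n := by
    rw [hP, natDegree_finsetProd_X_sub_C_eq_card, Finset.card_erase_of_mem hmem]
    have := Finset.card_pos.2 ⟨x0, hmem⟩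
    omega
  have h1 := RL_mom_poly f P n hdeg
  rw [Finset.sum_eq_zero (s := Finset.range n)] at h1
  · rw [Finset.sum_eq_single x0] at h1
    · rcases mul_eq_zero.1 h1 with h2 | h2
      · exact hx0' h2
      · rw [hP, eval_prod, Finset.prod_eq_zero_iff] at h2
        obtain ⟨y, hy, hy2⟩ := h2
        simp [sub_eq_zero] at hy2
        simp [hy2] at hy
    · intro b _ hb
      by_cases hfb : f b = 0
      · simp [hfb]
      · have : P.eval b = 0 := by
          rw [hP, eval_prod]
          refine Finset.prod_eq_zero (i := b) ?_ (by simp)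
          simp [RLsupp, hfb, hb]
        simp [this]
    · simp
  · intro i hi
    rw [h i (Finset.mem_range.1 hi), mul_zero]

theorem RL_sum (f : F → F) (n : ℕ) (h : ∀ i < n, RLmom f i = 0)
    (hs : (RLsupp f).card = n + 1) :
    RLmom f (n + 1) = (∑ x ∈ RLsupp f, x) * RLmom f n := by
  set P : F[X] := ∏ y ∈ RLsupp f, (X - C y) with hP
  have hdeg : P.natDegree = n + 1 := by
    rw [hP, natDegree_finsetProd_X_sub_C_eq_card, hs]
  have h1 := RL_mom_poly f P (n + 2) (by omega)
  rw [Finset.sum_range_succ, Finset.sum_range_succ, Finset.sum_eq_zero (s := Finset.range n),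
    Finset.sum_eq_zero] at h1
  · have hc1 : P.coeff (n + 1) = 1 := by
      have : P.Monic := monic_prod_of_monic _ _ fun i _ => monic_X_sub_C i
      rw [← hdeg]; exact this
    have hc2 : P.coeff n = - ∑ x ∈ RLsupp f, x := by
      have := prod_X_sub_C_coeff_card_pred (RLsupp f) (fun x => x) (by omega)
      rw [hs] at this
      exact this
    rw [hc1, hc2] at h1
    linear_combination -h1
  · intro x _
    by_cases hfb : f x = 0
    · simp [hfb]
    · have : P.eval x = 0 := by
        rw [hP, eval_prod]
        refine Finset.prod_eq_zero (i := x) ?_ (by simp)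
        simp [RLsupp, hfb]
      simp [this]
  · intro i hi
    rw [h i (Finset.mem_range.1 hi), mul_zero]

theorem RL_exists (S : Finset F) (n : ℕ) (hS : S.card = n + 1) (l : F) (hl : l ≠ 0) :
    ∃ f : F → F, RLsupp f = S ∧ (∀ i < n, RLmom f i = 0) ∧ RLmom f n = l := by
  refine ⟨fun x => if x ∈ S then l / ∏ y ∈ S.erase x, (x - y) else 0, ?_, ?_⟩
  · ext x
    simp only [RLsupp, Finset.mem_filter, Finset.mem_univ, true_and]
    by_cases hx : x ∈ S
    · simp only [hx, if_true, iff_true]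
      refine div_ne_zero hl (Finset.prod_ne_zero_iff.2 fun y hy => sub_ne_zero.2 ?_)
      exact (Finset.ne_of_mem_erase hy).symm
    · simp [hx]
  · have key : ∀ i < n + 1, RLmom (fun x => if x ∈ S then l / ∏ y ∈ S.erase x, (x - y) else 0) i
        = l * (X ^ i : F[X]).coeff n := by
      intro i hi
      have := Lagrange.coeff_eq_sum (s := S) (v := fun x : F => x) (fun x _ y _ h => h)
        (P := (X ^ i : F[X])) (by rw [degree_X_pow, hS]; exact_mod_cast hi)
      rw [hS, Nat.add_sub_cancel] at this
      rw [this, RLmom, Finset.mul_sum]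
      simp only [ite_mul, zero_mul, Finset.sum_ite_mem, Finset.univ_inter]
      refine Finset.sum_congr rfl fun x _ => ?_
      simp
      ring
    refine ⟨fun i hi => ?_, ?_⟩
    · rw [key i (by omega), coeff_X_pow, if_neg (by omega), mul_zero]
    · rw [key n (by omega), coeff_X_pow, if_pos rfl, mul_one]

def RLsets (F : Type*) [Field F] [Fintype F] [DecidableEq F] (n : ℕ) (e : F) : Finset (Finset F) :=
  (Finset.powersetCard n Finset.univ).filter (fun S => ∑ x ∈ S, x = e)

theorem RL_sets_le (n : ℕ) (hn : (n : F) ≠ 0) (e e' : F) :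
    (RLsets F n e).card ≤ (RLsets F n e').card := by
  refine Finset.card_le_card_of_injOn
    (fun S => S.map (addRightEmbedding ((e' - e) / n))) ?_ ?_
  · intro S hS
    simp only [RLsets, Finset.coe_filter, Finset.mem_powersetCard, Set.mem_ofPred_eq] at hS ⊢
    refine ⟨⟨Finset.subset_univ _, by simp [hS.1.2]⟩, ?_⟩
    simp [Finset.sum_add_distrib, hS.1.2, hS.2]
    field_simp
    ring
  · intro S _ T _ h
    exact Finset.map_injective _ h

theorem RL_sets_card (n : ℕ) (hn : (n : F) ≠ 0) (e : F) :
    Fintype.card F * (RLsets F n e).card = (Fintype.card F).choose n := by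
  have h1 := Finset.card_eq_sum_card_fiberwise (s := Finset.powersetCard n (Finset.univ : Finset F))
    (t := Finset.univ) (f := fun S => ∑ x ∈ S, x) (fun _ _ => by simp)
  rw [Finset.card_powersetCard, Finset.card_univ] at h1
  rw [h1, Finset.sum_congr rfl (g := fun _ => (RLsets F n e).card)]
  · simp
  · intro e' _
    exact le_antisymm (RL_sets_le n hn e' e) (RL_sets_le n hn e e')

def RLN (F : Type*) [Field F] [Fintype F] [DecidableEq F] (n : ℕ) (b0 b1 : F) : Set ((F → F) × F) :=
  {z | (∀ i < n, RLmom z.1 i = 0) ∧ RLmom z.1 n + b0 * z.2 = 0 ∧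
    RLmom z.1 (n + 1) + b1 * z.2 = 0 ∧ z.2 ≠ 0 ∧ (RLsupp z.1).card = n + 1}

theorem RL_N_zero (n : ℕ) (b1 : F) : RLN F n 0 b1 = ∅ := by
  ext ⟨f, u⟩
  simp only [RLN, Set.mem_ofPred_eq, Set.mem_empty_iff_false, iff_false]
  rintro ⟨h1, h2, h3, h4, h5⟩
  have : f = 0 := RL_zero f (n + 1) (fun i hi => by
    rcases Nat.lt_succ_iff_lt_or_eq.1 hi with h | h
    · exact h1 i h
    · subst h; simpa using h2) h5.le
  subst this
  simp [RLsupp] at h5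

theorem RL_N_card (n : ℕ) (b0 b1 : F) (hb : b0 ≠ 0) :
    (RLN F n b0 b1).ncard = (RLsets F (n + 1) (b1 / b0)).card * (Fintype.card F - 1) := by
  have h0 : (RLsets F (n + 1) (b1 / b0)).card * (Fintype.card F - 1) =
      (((RLsets F (n + 1) (b1 / b0)) ×ˢ (Finset.univ.erase (0 : F)) : Finset (Finset F × F)) :
        Set (Finset F × F)).ncard := by
    rw [Set.ncard_coe_finset, Finset.card_product, Finset.card_erase_of_mem (Finset.mem_univ _),
      Finset.card_univ]
  rw [h0]
  refine Set.ncard_congr (fun z _ => (RLsupp z.1, z.2)) ?_ ?_ ?_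
  · rintro ⟨f, u⟩ ⟨h1, h2, h3, h4, h5⟩
    dsimp only at *
    have := RL_sum f n h1 h5
    simp only [RLsets, Finset.coe_product, Set.mem_prod, Finset.mem_coe, Finset.mem_filter,
      Finset.mem_powersetCard, Finset.mem_erase, Finset.mem_univ, and_true]
    refine ⟨⟨⟨Finset.subset_univ _, h5⟩, ?_⟩, h4⟩
    rw [eq_div_iff hb]
    apply mul_right_cancel₀ h4
    linear_combination (∑ x ∈ RLsupp f, x) * h2 - h3 + this
  · rintro ⟨f, u⟩ ⟨g, v⟩ ⟨h1, h2, h3, h4, h5⟩ ⟨k1, k2, k3, k4, k5⟩ h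
    simp only [Prod.mk.injEq] at h
    obtain ⟨hs, rfl⟩ := h
    dsimp only at *
    have hm : ∀ i, RLmom (f - g) i = RLmom f i - RLmom g i := fun i => by
      simp [RLmom, sub_mul]
    have : f - g = 0 := RL_zero (f - g) (n + 1) (fun i hi => by
      rw [hm]
      rcases Nat.lt_succ_iff_lt_or_eq.1 hi with h | h
      · rw [h1 i h, k1 i h, sub_zero]
      · subst h; linear_combination h2 - k2) (by
      rw [← h5]
      refine Finset.card_le_card fun x hx => ?_
      by_contra hx2
      have hx3 := hx2
      rw [hs] at hx3
      simp only [RLsupp, Finset.mem_filter, Finset.mem_univ, true_and, not_not, Pi.sub_apply]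
        at hx hx2 hx3
      simp [hx2, hx3] at hx)
    rw [sub_eq_zero.1 this]
  · rintro ⟨S, u⟩ h
    simp only [RLsets, Finset.coe_product, Set.mem_prod, Finset.mem_coe, Finset.mem_filter,
      Finset.mem_powersetCard, Finset.mem_erase, Finset.mem_univ, and_true] at h
    obtain ⟨⟨⟨_, hS⟩, he⟩, hu⟩ := h
    obtain ⟨f, hf, h1, h2⟩ := RL_exists S n hS (-(b0 * u)) (neg_ne_zero.2 (mul_ne_zero hb hu))
    refine ⟨(f, u), ⟨h1, ?_, ?_, hu, by rw [hf, hS]⟩, by simp [hf]⟩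
    · simp [h2]
    · have := RL_sum f n h1 (by rw [hf, hS])
      rw [hf, he, h2] at this
      dsimp only
      rw [this]
      field_simp
      ring


def RLdual (n : ℕ) (a : Matrix (Fin 2) (Fin 2) F) (z : (F → F) × F × F) : Prop :=
  (∀ i < n, RLmom z.1 i = 0) ∧ RLmom z.1 n + a 0 0 * z.2.1 + a 0 1 * z.2.2 = 0 ∧
    RLmom z.1 (n + 1) + a 1 0 * z.2.1 + a 1 1 * z.2.2 = 0

def RLwt (z : (F → F) × F × F) : ℕ :=
  (RLsupp z.1).card + (if z.2.1 = 0 then 0 else 1) + (if z.2.2 = 0 then 0 else 1)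

theorem RL_supp_ge (n : ℕ) (a : Matrix (Fin 2) (Fin 2) F) (ha : IsUnit a.det)
    (z : (F → F) × F × F) (hz : RLdual n a z) (hne : z ≠ 0) : n + 1 ≤ (RLsupp z.1).card := by
  obtain ⟨f, u, v⟩ := z
  obtain ⟨h1, h2, h3⟩ := hz
  dsimp only at *
  by_contra hlt
  have hf : f = 0 := RL_zero f n h1 (by omega)
  subst hf
  have hm : ∀ i, RLmom (0 : F → F) i = 0 := fun i => by simp [RLmom]
  rw [hm, zero_add] at h2 h3
  have hd := ha.ne_zero
  rw [Matrix.det_fin_two] at hd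
  apply hne
  have hu : u = 0 := by
    apply (mul_eq_zero.1 (_ : (a 0 0 * a 1 1 - a 0 1 * a 1 0) * u = 0)).resolve_left hd
    linear_combination a 1 1 * h2 - a 0 1 * h3
  have hv : v = 0 := by
    apply (mul_eq_zero.1 (_ : (a 0 0 * a 1 1 - a 0 1 * a 1 0) * v = 0)).resolve_left hd
    linear_combination a 0 0 * h3 - a 1 0 * h2
  rw [hu, hv]; rfl

theorem RL_supp_ge2 (n : ℕ) (a : Matrix (Fin 2) (Fin 2) F)
    (f : F → F) (hz : RLdual n a (f, 0, 0)) (hne : f ≠ 0) : n + 3 ≤ (RLsupp f).card := by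
  obtain ⟨h1, h2, h3⟩ := hz
  dsimp only at *
  simp only [mul_zero, add_zero] at h2 h3
  by_contra hlt
  apply hne
  refine RL_zero f (n + 2) (fun i hi => ?_) (by omega)
  have : i < n ∨ i = n ∨ i = n + 1 := by omega
  rcases this with h | rfl | rfl
  · exact h1 i h
  · exact h2
  · exact h3

theorem RL_wt_ge (n : ℕ) (a : Matrix (Fin 2) (Fin 2) F) (ha : IsUnit a.det)
    (z : (F → F) × F × F) (hz : RLdual n a z) (hne : z ≠ 0) : n + 2 ≤ RLwt z := by
  have h1 := RL_supp_ge n a ha z hz hne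
  obtain ⟨f, u, v⟩ := z
  simp only [RLwt] at *
  by_cases hu : u = 0
  · by_cases hv : v = 0
    · subst hu hv
      have := RL_supp_ge2 n a f hz (by rintro rfl; exact hne rfl)
      omega
    · simp only [hv, if_false]; omega
  · simp only [hu, if_false]; omega

theorem RL_wt_eq (n : ℕ) (a : Matrix (Fin 2) (Fin 2) F) (ha : IsUnit a.det) :
    {z : (F → F) × F × F | RLdual n a z ∧ RLwt z = n + 2} =
      (fun y : (F → F) × F => (y.1, y.2, (0 : F))) '' RLN F n (a 0 0) (a 1 0) ∪
      (fun y : (F → F) × F => (y.1, (0 : F), y.2)) '' RLN F n (a 0 1) (a 1 1) := by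
  ext ⟨f, u, v⟩
  simp only [Set.mem_ofPred_eq, Set.mem_union, Set.mem_image, RLN, Prod.exists, Prod.mk.injEq]
  constructor
  · rintro ⟨hz, hw⟩
    have hne : (f, u, v) ≠ 0 := by
      intro h
      rw [h] at hw
      simp [RLwt, RLsupp] at hw
    have h1 := RL_supp_ge n a ha _ hz hne
    simp only [RLwt] at *
    by_cases hu : u = 0
    · by_cases hv : v = 0
      · subst hu hv
        have := RL_supp_ge2 n a f hz (by rintro rfl; exact hne rfl)
        simp at hw
        omega
      · subst hu
        obtain ⟨k1, k2, k3⟩ := hz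
        simp only [hv, if_false, if_true] at hw
        refine Or.inr ⟨f, v, ⟨k1, ?_, ?_, hv, by omega⟩, rfl, rfl, rfl⟩
        · simpa using k2
        · simpa using k3
    · by_cases hv : v = 0
      · subst hv
        obtain ⟨k1, k2, k3⟩ := hz
        simp only [hu, if_false, if_true] at hw
        refine Or.inl ⟨f, u, ⟨k1, ?_, ?_, hu, by omega⟩, rfl, rfl, rfl⟩
        · simpa using k2
        · simpa using k3
      · simp only [hu, hv, if_false] at hw
        omega
  · rintro (⟨g, w, ⟨h1, h2, h3, h4, h5⟩, rfl, rfl, rfl⟩ | ⟨g, w, ⟨h1, h2, h3, h4, h5⟩, rfl, rfl, rfl⟩)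
    · exact ⟨⟨h1, by simpa using h2, by simpa using h3⟩, by simp [RLwt, h4, h5]⟩
    · exact ⟨⟨h1, by simpa using h2, by simpa using h3⟩, by simp [RLwt, h4, h5]⟩

theorem RL_wt_card (n : ℕ) (a : Matrix (Fin 2) (Fin 2) F) (ha : IsUnit a.det) :
    {z : (F → F) × F × F | RLdual n a z ∧ RLwt z = n + 2}.ncard =
      (RLN F n (a 0 0) (a 1 0)).ncard + (RLN F n (a 0 1) (a 1 1)).ncard := by
  rw [RL_wt_eq n a ha, Set.ncard_union_eq _ (Set.toFinite _) (Set.toFinite _),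
    Set.ncard_image_of_injective, Set.ncard_image_of_injective]
  · rintro ⟨f, u⟩ ⟨g, v⟩ h; simpa using h
  · rintro ⟨f, u⟩ ⟨g, v⟩ h; simpa using h
  · rw [Set.disjoint_left]
    rintro _ ⟨⟨f, u⟩, ⟨-, -, -, h4, -⟩, rfl⟩ ⟨⟨g, w⟩, _, h⟩
    simp only [Prod.mk.injEq] at h
    exact h4 h.2.1.symm

theorem RL_N_card_rat (n : ℕ) (hn : ((n + 1 : ℕ) : F) ≠ 0) (b0 b1 : F) (hb : b0 ≠ 0) :
    ((RLN F n b0 b1).ncard : ℚ) = ((Fintype.card F : ℚ) - 1) / (Fintype.card F) *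
      (((Fintype.card F).choose (n + 1) : ℕ) : ℚ) := by
  rw [RL_N_card n b0 b1 hb, ← RL_sets_card (n + 1) hn (b1 / b0)]
  have : 1 ≤ Fintype.card F := Fintype.card_pos
  have h' : (Fintype.card F : ℚ) ≠ 0 := by positivity
  push_cast [Nat.cast_sub this]
  field_simp

/-- Splitting a word of length `q + 2`. -/
def RLsplit {q : ℕ} (e : Fin q ≃ F) (c : Fin (q + 2) → F) : (F → F) × F × F :=
  (fun x => c (e.symm x).castSucc.castSucc, c (Fin.last q).castSucc, c (Fin.last (q + 1)))

theorem RLsplit_bij {q : ℕ} (e : Fin q ≃ F) : Function.Bijective (RLsplit e) := by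
  constructor
  · intro c d h
    simp only [RLsplit, Prod.mk.injEq] at h
    obtain ⟨h1, h2, h3⟩ := h
    funext j
    refine Fin.lastCases h3 (fun j => Fin.lastCases h2 (fun j => ?_) j) j
    simpa using congrFun h1 (e j)
  · rintro ⟨f, u, v⟩
    refine ⟨Fin.snoc (Fin.snoc (fun j => f (e j)) u : Fin (q + 1) → F) v, ?_⟩
    simp [RLsplit]

theorem RLsplit_wt {q : ℕ} (e : Fin q ≃ F) (c : Fin (q + 2) → F) :
    RLwt (RLsplit e c) = hammingNorm c := by
  rw [hammingNorm, Finset.card_filter, Fin.sum_univ_castSucc, Fin.sum_univ_castSucc, RLwt, RLsupp,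
    Finset.card_filter, ← e.sum_comp]
  simp [RLsplit]
  congr!

theorem RLsplit_dual {n q : ℕ} (e : Fin q ≃ F) (a : Matrix (Fin 2) (Fin 2) F)
    (G : Matrix (Fin (n + 2)) (Fin (q + 2)) F)
    (hGv : ∀ (i : Fin (n + 2)) (j : Fin (q + 2)) (h : (j : ℕ) < q),
      G i j = e ⟨j, h⟩ ^ (i : ℕ))
    (hGc1 : ∀ (i : Fin (n + 2)) (j : Fin (q + 2)), (j : ℕ) = q →
      G i j = if (i : ℕ) = n then a 0 0 else if (i : ℕ) = n + 1 then a 1 0 else 0)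
    (hGc2 : ∀ (i : Fin (n + 2)) (j : Fin (q + 2)), (j : ℕ) = q + 1 →
      G i j = if (i : ℕ) = n then a 0 1 else if (i : ℕ) = n + 1 then a 1 1 else 0)
    (c : Fin (q + 2) → F) :
    (∀ y : Fin (q + 2) → F, (∃ x : Fin (n + 2) → F, y = Matrix.vecMul x G) →
          ∑ i, c i * y i = 0) ↔ RLdual n a (RLsplit e c) := by
  have step1 : (∀ y : Fin (q + 2) → F, (∃ x : Fin (n + 2) → F, y = Matrix.vecMul x G) →
          ∑ i, c i * y i = 0) ↔ ∀ i, ∑ j, c j * G i j = 0 := by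
    constructor
    · intro h i
      have := h _ ⟨Pi.single i 1, rfl⟩
      simpa using this
    · rintro h _ ⟨x, rfl⟩
      simp only [Matrix.vecMul, dotProduct, Finset.mul_sum]
      rw [Finset.sum_comm]
      refine Finset.sum_eq_zero fun i _ => ?_
      rw [← mul_zero (x i), ← h i, Finset.mul_sum]
      exact Finset.sum_congr rfl fun j _ => by ring
  have step2 : ∀ i : Fin (n + 2), ∑ j, c j * G i j = RLmom (RLsplit e c).1 i +
      (RLsplit e c).2.1 * (if (i : ℕ) = n then a 0 0 else if (i : ℕ) = n + 1 then a 1 0 else 0) +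
      (RLsplit e c).2.2 * (if (i : ℕ) = n then a 0 1 else if (i : ℕ) = n + 1 then a 1 1 else 0) := by
    intro i
    rw [Fin.sum_univ_castSucc, Fin.sum_univ_castSucc, hGc1 i _ (by simp), hGc2 i _ (by simp)]
    simp only [RLsplit, RLmom]
    rw [← e.sum_comp]
    congr 2
    refine Finset.sum_congr rfl fun j _ => ?_
    rw [hGv i _ (by simp)]
    simp
  rw [step1]
  simp only [step2]
  constructor
  · intro h
    refine ⟨fun i hi => ?_, ?_, ?_⟩
    · have := h ⟨i, by omega⟩
      simpa [hi.ne, (show i ≠ n + 1 by omega)] using this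
    · have := h ⟨n, by omega⟩
      simp only [if_true] at this
      linear_combination this
    · have := h ⟨n + 1, by omega⟩
      simp only [if_true, (show n + 1 ≠ n by omega), if_false] at this
      linear_combination this
  · rintro ⟨h1, h2, h3⟩ ⟨i, hi⟩
    have : i < n ∨ i = n ∨ i = n + 1 := by omega
    rcases this with h | rfl | rfl
    · simp [h.ne, (show i ≠ n + 1 by omega), h1 i h]
    · simp only [if_true]
      linear_combination h2
    · simp only [if_true, (show n + 1 ≠ n by omega), if_false]
      linear_combination h3

end core


/-- over the full field, when p does not divide k-1, the dual distance is k and the number of weight-k dual codewords is 2(q-1)/q·C(q,k-1) when the first row of M has no zero entry, and (q-1)/q·C(q,k-1) when exactly one of a₁₁, a₁₂ is zero. -/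
theorem stmt11 (p m q k : ℕ) (hp : p.Prime) (hm : 0 < m) (hq : q = p ^ m)
    (F : Type*) [Field F] [Fintype F] [DecidableEq F] (hF : Fintype.card F = q)
    (hrange : (p = 2 ∧ 4 ≤ k ∧ k ≤ q - 2) ∨ (Odd p ∧ 3 ≤ k ∧ k ≤ q))
    (hnd : ¬ p ∣ (k - 1))
    (α : Fin q → F) (hα : Function.Bijective α)
    (a : Matrix (Fin 2) (Fin 2) F) (ha : IsUnit a.det)
    (G₃ : Matrix (Fin k) (Fin (q + 2)) F)
    (hGv : ∀ (i : Fin k) (j : Fin (q + 2)) (h : (j : ℕ) < q),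
      G₃ i j = α ⟨j, h⟩ ^ (i : ℕ))
    (hGc1 : ∀ (i : Fin k) (j : Fin (q + 2)), (j : ℕ) = q →
      G₃ i j = if (i : ℕ) = k - 2 then a 0 0 else if (i : ℕ) = k - 1 then a 1 0 else 0)
    (hGc2 : ∀ (i : Fin k) (j : Fin (q + 2)), (j : ℕ) = q + 1 →
      G₃ i j = if (i : ℕ) = k - 2 then a 0 1 else if (i : ℕ) = k - 1 then a 1 1 else 0) :
    -- the minimum distance of the dual code is k
    ((∃ c : Fin (q + 2) → F,
        (∀ y : Fin (q + 2) → F, (∃ x : Fin k → F, y = Matrix.vecMul x G₃) →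
          ∑ i, c i * y i = 0) ∧ c ≠ 0 ∧ hammingNorm c = k) ∧
      (∀ c : Fin (q + 2) → F,
        (∀ y : Fin (q + 2) → F, (∃ x : Fin k → F, y = Matrix.vecMul x G₃) →
          ∑ i, c i * y i = 0) → c ≠ 0 → k ≤ hammingNorm c)) ∧
    (a 0 0 ≠ 0 ∧ a 0 1 ≠ 0 →
      ({c : Fin (q + 2) → F |
        (∀ y : Fin (q + 2) → F, (∃ x : Fin k → F, y = Matrix.vecMul x G₃) →
          ∑ i, c i * y i = 0) ∧ hammingNorm c = k}.ncard : ℚ) =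
        2 * ((q : ℚ) - 1) / q * ((q.choose (k - 1) : ℕ) : ℚ)) ∧
    ((a 0 0 = 0 ∧ a 0 1 ≠ 0) ∨ (a 0 0 ≠ 0 ∧ a 0 1 = 0) →
      ({c : Fin (q + 2) → F |
        (∀ y : Fin (q + 2) → F, (∃ x : Fin k → F, y = Matrix.vecMul x G₃) →
          ∑ i, c i * y i = 0) ∧ hammingNorm c = k}.ncard : ℚ) =
        ((q : ℚ) - 1) / q * ((q.choose (k - 1) : ℕ) : ℚ)) := by
  obtain ⟨n, rfl⟩ : ∃ n, k = n + 2 := ⟨k - 2, by omega⟩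
  have e1 : n + 2 - 1 = n + 1 := by omega
  have e2 : n + 2 - 2 = n := by omega
  rw [e1] at hnd
  simp only [e1, e2] at hGc1 hGc2 ⊢
  have hkq : n + 2 ≤ q := by omega
  have : Fact p.Prime := ⟨hp⟩
  have : CharP F p := charP_of_card_eq_prime_pow (hF.trans hq)
  have hn : ((n + 1 : ℕ) : F) ≠ 0 := fun h => hnd ((CharP.cast_eq_zero_iff F p _).1 h)
  have hdual := RLsplit_dual (Equiv.ofBijective α hα) a G₃ hGv hGc1 hGc2
  simp only [hdual, ← RLsplit_wt (Equiv.ofBijective α hα)]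
  have hbij := RLsplit_bij (Equiv.ofBijective α hα)
  have hzero : RLsplit (Equiv.ofBijective α hα) 0 = 0 := rfl
  generalize RLsplit (Equiv.ofBijective α hα) = Ψ at hbij hdual hzero ⊢
  have hΨ : ∀ c, Ψ c = 0 ↔ c = 0 := by
    exact fun c => ⟨fun h => hbij.1 (h.trans hzero.symm), fun h => h ▸ hzero⟩
  have hcard : {c | RLdual n a (Ψ c) ∧ RLwt (Ψ c) = n + 2}.ncard =
      (RLN F n (a 0 0) (a 1 0)).ncard + (RLN F n (a 0 1) (a 1 1)).ncard := by
    rw [← RL_wt_card n a ha]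
    refine Set.ncard_congr (fun c _ => Ψ c) (fun c h => h) (fun c d _ _ h => hbij.1 h) ?_
    intro z hz
    obtain ⟨c, rfl⟩ := hbij.2 z
    exact ⟨c, hz, rfl⟩
  have hN := RL_N_card_rat (F := F) n hn
  have hN0 := RL_N_zero (F := F) n
  rw [hF] at hN
  have hpos : 0 < ((q : ℚ) - 1) / q * ((q.choose (n + 1) : ℕ) : ℚ) := by
    have h1 : (2 : ℚ) ≤ q := by exact_mod_cast (by omega : 2 ≤ q)
    have h2 : (0 : ℚ) < ((q.choose (n + 1) : ℕ) : ℚ) := by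
      exact_mod_cast Nat.choose_pos (by omega)
    have h3 : (0 : ℚ) < (q : ℚ) - 1 := by linarith
    positivity
  have hA : a 0 0 ≠ 0 ∧ a 0 1 ≠ 0 →
      ({c | RLdual n a (Ψ c) ∧ RLwt (Ψ c) = n + 2}.ncard : ℚ) =
        2 * ((q : ℚ) - 1) / q * ((q.choose (n + 1) : ℕ) : ℚ) := by
    rintro ⟨h0, h1⟩
    rw [hcard, Nat.cast_add, hN _ _ h0, hN _ _ h1]
    ring
  have hB : (a 0 0 = 0 ∧ a 0 1 ≠ 0) ∨ (a 0 0 ≠ 0 ∧ a 0 1 = 0) →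
      ({c | RLdual n a (Ψ c) ∧ RLwt (Ψ c) = n + 2}.ncard : ℚ) =
        ((q : ℚ) - 1) / q * ((q.choose (n + 1) : ℕ) : ℚ) := by
    rintro (⟨h0, h1⟩ | ⟨h0, h1⟩)
    · rw [hcard, Nat.cast_add, h0, hN0, hN _ _ h1]
      simp
    · rw [hcard, Nat.cast_add, h1, hN0, hN _ _ h0]
      simp
  refine ⟨⟨?_, fun c hc hne => RL_wt_ge n a ha _ hc fun h => hne ((hΨ c).1 h)⟩, hA, hB⟩
  have hne : {c | RLdual n a (Ψ c) ∧ RLwt (Ψ c) = n + 2}.ncard ≠ 0 := by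
    intro h
    rw [h] at hA hB
    by_cases h0 : a 0 0 = 0
    · by_cases h1 : a 0 1 = 0
      · have := ha.ne_zero
        simp [Matrix.det_fin_two, h0, h1] at this
      · exact hpos.ne (by simpa using hB (Or.inl ⟨h0, h1⟩))
    · by_cases h1 : a 0 1 = 0
      · exact hpos.ne (by simpa using hB (Or.inr ⟨h0, h1⟩))
      · have := hA ⟨h0, h1⟩
        rw [mul_div_assoc, mul_assoc] at this
        push_cast at this
        linarith
  obtain ⟨c, hc1, hc2⟩ := Set.nonempty_of_ncard_ne_zero hne
  refine ⟨c, hc1, ?_, hc2⟩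
  intro h
  rw [(hΨ c).2 h] at hc2
  simp [RLwt, RLsupp] at hc2
end

section
/- Suppose (p = 2 and 4 ≤ k ≤ q−2) or (p odd and 3 ≤ k ≤ q), and suppose p divides k−1. Then the minimum distance of RL_k^⊥(F_q, M) equals k, and the number A of codewords of Hamming weight exactly k in RL_k^⊥(F_q, M) is as follows, where C(·,·) denotes the binomial coefficient: if a_{11}a_{12}a_{21}a_{22} ≠ 0, then A = (2(q−1)/q)·C(q, k−1) + (−1)^{k+(k−1)/p}·(2(q−1)/q)·C(q/p, (k−1)/p); if (a_{11}a_{12}a_{21} ≠ 0 and a_{22} = 0) or (a_{11}a_{12}a_{22} ≠ 0 and a_{21} = 0), then A = (2(q−1)/q)·C(q, k−1) + (−1)^{k−1+(k−1)/p}·((q−1)(q−2)/q)·C(q/p, (k−1)/p); if (a_{11}a_{21}a_{22} ≠ 0 and a_{12} = 0) or (a_{12}a_{21}a_{22} ≠ 0 and a_{11} = 0), then A = ((q−1)/q)·C(q, k−1) + (−1)^{k+(k−1)/p}·((q−1)/q)·C(q/p, (k−1)/p); if (a_{12}a_{21} ≠ 0 and a_{11} = a_{22} = 0) or (a_{11}a_{22}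 ≠ 0 and a_{12} = a_{21} = 0), then A = ((q−1)/q)·C(q, k−1) + (−1)^{k−1+(k−1)/p}·((q−1)^2/q)·C(q/p, (k−1)/p). -/
open Finset in
/-- number of n-subsets with sum b -/
def nsum (F : Type*) [Field F] [Fintype F] [DecidableEq F] (n : ℕ) (b : F) : ℕ :=
  #{S ∈ (univ : Finset F).powersetCard n | ∑ x ∈ S, x = b}

open Finset in
lemma psi_sum {F : Type*} [Field F] [DecidableEq F] (ψ : AddChar F ℂ) (S : Finset F) :
    ψ (∑ x ∈ S, x) = ∏ x ∈ S, ψ x := by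
  induction S using Finset.induction_on with
  | empty => simp
  | insert x S hx ih => rw [sum_insert hx, prod_insert hx, AddChar.map_add_eq_mul, ih]

open Finset in
lemma char_fiber {F : Type*} [Field F] [Fintype F] [DecidableEq F] (p : ℕ) (hp : p.Prime)
    [CharP F p] (ψ : AddChar F ℂ) (hψ : ψ ≠ 1) :
    ∃ ζ : ℂ, IsPrimitiveRoot ζ p ∧ (∀ x, ψ x ∈ Polynomial.nthRootsFinset p (1 : ℂ)) ∧
      ∀ z ∈ Polynomial.nthRootsFinset p (1 : ℂ), #{x : F | ψ x = z} = Fintype.card F / p := by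
  obtain ⟨x0, hx0⟩ := AddChar.ne_one_iff.1 hψ
  have hpow : ∀ x, ψ x ^ p = 1 := by
    intro x
    rw [← AddChar.map_nsmul_eq_pow]
    simp [CharP.cast_eq_zero]
  have hprim : IsPrimitiveRoot (ψ x0) p := by
    have : orderOf (ψ x0) = p := by
      have := (Nat.dvd_prime hp).1 (orderOf_dvd_of_pow_eq_one (hpow x0))
      rcases this with h | h
      · exact absurd (orderOf_eq_one_iff.1 h) hx0
      · exact h
    rw [← this]; exact IsPrimitiveRoot.orderOf _
  have hmem : ∀ x, ψ x ∈ Polynomial.nthRootsFinset p (1 : ℂ) := fun x =>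
    (Polynomial.mem_nthRootsFinset hp.pos _).2 (hpow x)
  have hfib : ∀ z ∈ Polynomial.nthRootsFinset p (1 : ℂ), #{x : F | ψ x = z} = #{x : F | ψ x = 1} := by
    intro z hz
    have hz' := (Polynomial.mem_nthRootsFinset hp.pos _).1 hz
    have : NeZero p := ⟨hp.ne_zero⟩
    obtain ⟨i, -, hi⟩ := hprim.eq_pow_of_pow_eq_one hz'
    have hi2 : ψ (i • x0) = z := by rw [AddChar.map_nsmul_eq_pow, hi]
    have hz0 : z ≠ 0 := by rintro rfl; simp [hp.ne_zero] at hz'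
    refine Finset.card_bij' (fun x _ => x - i • x0) (fun x _ => x + i • x0) ?_ ?_ ?_ ?_
    · intro x hx
      simp only [mem_filter, mem_univ, true_and] at hx ⊢
      rw [AddChar.map_sub_eq_div, hi2, hx, div_self hz0]
    · intro x hx
      simp only [mem_filter, mem_univ, true_and] at hx ⊢
      rw [AddChar.map_add_eq_mul, hi2, hx, one_mul]
    · intro x _; simp
    · intro x _; simp
  refine ⟨ψ x0, hprim, hmem, ?_⟩
  have hsum : Fintype.card F = p * #{x : F | ψ x = 1} := by
    have := Finset.card_eq_sum_card_fiberwise (s := (univ : Finset F)) (f := ψ)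
      (t := Polynomial.nthRootsFinset p (1 : ℂ)) (fun x _ => hmem x)
    rw [Finset.sum_congr rfl hfib] at this
    simpa [hprim.card_nthRootsFinset] using this
  intro z hz
  rw [hfib z hz, hsum, Nat.mul_div_cancel_left _ hp.pos]

open Finset Polynomial in
lemma char_esymm {F : Type*} [Field F] [Fintype F] [DecidableEq F] (p : ℕ) (hp : p.Prime)
    [CharP F p] (ψ : AddChar F ℂ) (hψ : ψ ≠ 1) (n : ℕ) (hn : p ∣ n) :
    ∑ S ∈ (univ : Finset F).powersetCard n, ψ (∑ x ∈ S, x) =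
      (-1) ^ (n + n / p) * ((Fintype.card F / p).choose (n / p) : ℂ) := by
  obtain ⟨ζ, hζ, hmem, hfib⟩ := char_fiber p hp ψ hψ
  set t := Fintype.card F / p
  have h1 : ∏ x : F, (1 + C (ψ x) * X) = ((1 : ℂ[X]) - (-X) ^ p) ^ t := by
    rw [← Finset.prod_fiberwise_of_maps_to' (fun x _ => hmem x) (fun z => (1 + C z * X : ℂ[X]))]
    simp only [Finset.prod_const]
    rw [Finset.prod_congr rfl (fun z hz => by rw [hfib z hz]), Finset.prod_pow]
    congr 1
    have hζ' : IsPrimitiveRoot (C ζ : ℂ[X]) p := hζ.map_of_injective C_injective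
    have h2 := hζ'.pow_sub_pow_eq_prod_sub_mul (1 : ℂ[X]) (-X) hp.pos
    rw [one_pow] at h2
    rw [h2]
    refine Finset.prod_nbij C (fun z hz => ?_) (fun z _ w _ h => C_injective h) ?_ ?_
    · rw [mem_nthRootsFinset hp.pos] at hz ⊢
      rw [← C_pow, hz, C_1]
    · apply Finset.surjOn_of_injOn_of_card_le
      · intro z hz
        rw [mem_coe, mem_nthRootsFinset hp.pos] at hz ⊢
        rw [← C_pow, hz, C_1]
      · exact fun z _ w _ h => C_injective h
      · rw [hζ.card_nthRootsFinset, hζ'.card_nthRootsFinset]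
    · intro z _; ring
  have h3 : ∏ x : F, (1 + C (ψ x) * X) = ∑ S : Finset F, C (ψ (∑ x ∈ S, x)) * (X : ℂ[X]) ^ #S := by
    rw [Finset.prod_one_add, Finset.powerset_univ]
    refine Finset.sum_congr rfl fun S _ => ?_
    rw [Finset.prod_mul_distrib, Finset.prod_const, psi_sum, map_prod]
  have h4 := congrArg (fun P => coeff P n) (h3.symm.trans h1)
  simp only [finsetSum_coeff, coeff_C_mul, coeff_X_pow] at h4
  have h5 : ∑ S ∈ (univ : Finset F).powersetCard n, ψ (∑ x ∈ S, x) =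
      ∑ S : Finset F, ψ (∑ x ∈ S, x) * (if n = #S then 1 else 0) := by
    simp only [mul_ite, mul_one, mul_zero]
    rw [← Finset.sum_filter]
    refine Finset.sum_congr ?_ fun _ _ => rfl
    ext S; simp [Finset.mem_powersetCard, eq_comm]
  rw [h5, h4]
  obtain ⟨b, rfl⟩ := hn
  rw [Nat.mul_div_cancel_left _ hp.pos]
  have h6 : ((1 : ℂ[X]) - (-X) ^ p) ^ t = expand ℂ p ((1 + C (-(-1) ^ p) * X) ^ t) := by
    simp only [map_pow, map_add, map_mul, map_one, expand_C, expand_X]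
    congr 1
    rw [neg_pow]; simp; ring
  rw [h6, mul_comm p b, coeff_expand_mul hp.pos]
  rw [add_comm, add_pow]
  simp only [finsetSum_coeff, one_pow, mul_one, mul_pow, ← C_pow]
  rw [Finset.sum_congr rfl (g := fun i => if i = b then (((-(-1 : ℂ) ^ p) ^ b) * (t.choose b : ℂ)) else 0)]
  · rw [Finset.sum_ite_eq']
    split_ifs with h
    · congr 1
      rw [neg_pow, ← pow_mul, pow_add, mul_comm p b]; ring
    · have : t.choose b = 0 := Nat.choose_eq_zero_of_lt (by simpa using h)
      simp [this]
  · intro i _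
    rw [← C_eq_natCast, mul_assoc, mul_comm (X ^ i), ← mul_assoc, ← C_mul, coeff_C_mul, coeff_X_pow]
    by_cases h : i = b
    · subst h; simp
    · simp [h, Ne.symm h]

open Finset in
lemma nsum_scale {F : Type*} [Field F] [Fintype F] [DecidableEq F] (n : ℕ) (b : F) (hb : b ≠ 0) :
    nsum F n b = nsum F n 1 := by
  unfold nsum
  symm
  refine Finset.card_bij (fun S _ => S.map (Equiv.mulLeft₀ b hb).toEmbedding) ?_ ?_ ?_
  · intro S hS
    simp only [mem_filter, mem_powersetCard_univ, card_map, sum_map] at hS ⊢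
    refine ⟨hS.1, ?_⟩
    simp only [Equiv.coe_toEmbedding]
    have : ∀ x, (Equiv.mulLeft₀ b hb) x = b * x := fun x => rfl
    simp only [this]
    rw [← Finset.mul_sum, hS.2, mul_one]
  · intro S _ T _ h
    exact Finset.map_injective _ h
  · intro S hS
    simp only [mem_filter, mem_powersetCard_univ] at hS
    refine ⟨S.map (Equiv.mulLeft₀ b hb).symm.toEmbedding, ?_, ?_⟩
    · simp only [mem_filter, mem_powersetCard_univ, card_map, sum_map]
      refine ⟨hS.1, ?_⟩
      simp only [Equiv.coe_toEmbedding]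
      have : ∀ x, (Equiv.mulLeft₀ b hb).symm x = b⁻¹ * x := fun x => rfl
      simp only [this]
      rw [← Finset.mul_sum, hS.2, inv_mul_cancel₀ hb]
    · rw [Finset.map_map]; ext x; simp [mul_inv_cancel₀ hb]

open Finset in
lemma nsum_total {F : Type*} [Field F] [Fintype F] [DecidableEq F] (n : ℕ) :
    ∑ b : F, nsum F n b = (Fintype.card F).choose n := by
  unfold nsum
  have h := Finset.card_eq_sum_card_fiberwise (s := (univ : Finset F).powersetCard n)
    (f := fun S => ∑ x ∈ S, x) (t := univ) (fun x _ => by simp)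
  rw [← h, card_powersetCard, card_univ]

open Finset in
lemma nsum_formula {F : Type*} [Field F] [Fintype F] [DecidableEq F] (p : ℕ) (hp : p.Prime)
    [CharP F p] (n : ℕ) (hn : p ∣ n) :
    (∀ b : F, b ≠ 0 → (nsum F n b : ℚ) = ((Fintype.card F).choose n -
      (-1) ^ (n + n / p) * ((Fintype.card F / p).choose (n / p) : ℚ)) / Fintype.card F) ∧
    (nsum F n (0 : F) : ℚ) = ((Fintype.card F).choose n + (Fintype.card F - 1) *
      (-1) ^ (n + n / p) * ((Fintype.card F / p).choose (n / p) : ℚ)) / Fintype.card F := by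
  set q := Fintype.card F
  obtain ⟨ψ, hψ⟩ : ∃ ψ : AddChar F ℂ, ψ ≠ 1 := by
    refine ⟨AddChar.FiniteField.primitiveChar_to_Complex F, ?_⟩
    have := AddChar.FiniteField.primitiveChar_to_Complex_isPrimitive F one_ne_zero
    rwa [AddChar.mulShift_one] at this
  have h1 := char_esymm p hp ψ hψ n hn
  have h2 : ∑ S ∈ (univ : Finset F).powersetCard n, ψ (∑ x ∈ S, x) =
      ∑ b : F, (nsum F n b : ℂ) * ψ b := by
    rw [← Finset.sum_fiberwise_of_maps_to' (s := (univ : Finset F).powersetCard n)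
      (g := fun S => ∑ x ∈ S, x) (t := univ) (fun _ _ => mem_univ _) (fun b => ψ b)]
    simp [nsum]
  have h0 := AddChar.sum_eq_zero_of_ne_one hψ
  have h3 : ∑ b : F, (nsum F n b : ℂ) * ψ b = nsum F n (0 : F) - nsum F n (1 : F) := by
    have : ∀ b : F, (nsum F n b : ℂ) * ψ b = nsum F n (1 : F) * ψ b +
        (if b = 0 then (nsum F n (0 : F) - nsum F n (1 : F) : ℂ) else 0) := by
      intro b
      by_cases hb : b = 0
      · subst hb; simp
      · rw [nsum_scale n b hb]; simp [hb]
    rw [Finset.sum_congr rfl fun b _ => this b, Finset.sum_add_distrib, ← Finset.mul_sum, h0]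
    simp
  have h4 : (nsum F n (0 : F) : ℚ) - nsum F n (1 : F) =
      (-1) ^ (n + n / p) * ((q / p).choose (n / p) : ℚ) := by
    have := h3.symm.trans (h2.symm.trans h1)
    exact_mod_cast this
  have h5 : (nsum F n (0 : F) : ℚ) + (q - 1) * nsum F n (1 : F) = q.choose n := by
    have := nsum_total (F := F) n
    rw [← Finset.add_sum_erase _ _ (mem_univ (0 : F)), Finset.sum_congr rfl
      (fun b hb => nsum_scale n b (ne_of_mem_erase hb)), sum_const, card_erase_of_mem (mem_univ _),
      card_univ, smul_eq_mul] at this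
    have h := congrArg (Nat.cast : ℕ → ℚ) this
    have hq : 1 ≤ Fintype.card F := Fintype.card_pos
    push_cast [Nat.cast_sub hq] at h
    exact h
  have hq0 : (q : ℚ) ≠ 0 := by exact_mod_cast Fintype.card_ne_zero
  refine ⟨fun b hb => ?_, ?_⟩
  · rw [nsum_scale n b hb, eq_div_iff hq0]; linear_combination h5 - h4
  · rw [eq_div_iff hq0]; linear_combination h5 + (q - 1) * h4

open Finset in
lemma exists_ne_sum {F : Type*} [Field F] [Fintype F] [DecidableEq F] (n : ℕ) (b : F)
    (h1 : 1 ≤ n) (h2 : n < Fintype.card F) : ∃ T : Finset F, #T = n ∧ ∑ x ∈ T, x ≠ b := by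
  obtain ⟨U, -, hU⟩ := Finset.exists_subset_card_eq (s := (univ : Finset F)) (n := n - 1)
    (by rw [card_univ]; omega)
  have : 1 < #Uᶜ := by rw [card_compl]; omega
  obtain ⟨x, hx, y, hy, hxy⟩ := Finset.one_lt_card.1 this
  rw [mem_compl] at hx hy
  by_cases hb : ∑ z ∈ insert x U, z = b
  · refine ⟨insert y U, by rw [card_insert_of_notMem hy]; omega, ?_⟩
    rw [sum_insert hx] at hb
    rw [sum_insert hy, ← hb]
    simpa using hxy.symm
  · exact ⟨insert x U, by rw [card_insert_of_notMem hx]; omega, hb⟩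

open Finset in
lemma exists_sum_small {F : Type*} [Field F] [Fintype F] [DecidableEq F] (n : ℕ) (b : F)
    (h1 : 3 ≤ n) (h2 : 2 * n ≤ Fintype.card F) : ∃ T : Finset F, #T = n ∧ ∑ x ∈ T, x = b := by
  obtain ⟨T, hT, hTb⟩ := exists_ne_sum (n - 2) b (by omega) (by omega)
  set c := b - ∑ x ∈ T, x with hc
  have hc0 : c ≠ 0 := sub_ne_zero.2 (Ne.symm hTb)
  have hD : #{x : F | x + x = c} ≤ 1 := by
    rw [Finset.card_le_one]
    intro x hx y hy
    simp only [mem_filter, mem_univ, true_and] at hx hy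
    have h2 : (2 : F) ≠ 0 := by
      intro h; apply hc0; rw [← hx, ← two_mul, h, zero_mul]
    apply mul_left_cancel₀ h2
    rw [two_mul, two_mul, hx, hy]
  have hcard : #(T ∪ T.image (fun x => c - x) ∪ ({x : F | x + x = c} : Finset F)) < #(univ : Finset F) := by
    have e1 := card_union_le (T ∪ T.image (fun x => c - x)) ({x : F | x + x = c} : Finset F)
    have e2 := card_union_le T (T.image (fun x => c - x))
    have e3 := card_image_le (s := T) (f := fun x => c - x)
    rw [card_univ]; omega
  obtain ⟨x, -, hx⟩ := Finset.exists_mem_notMem_of_card_lt_card hcard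
  simp only [mem_union, mem_filter, mem_univ, true_and, mem_image, not_or, not_exists, not_and] at hx
  obtain ⟨⟨hx1, hx2⟩, hx3⟩ := hx
  have hy : c - x ∉ T := fun h => hx2 _ h (by ring)
  have hxy : x ∉ insert (c - x) T := by
    rw [mem_insert, not_or]; exact ⟨fun h => hx3 (by linear_combination h), hx1⟩
  refine ⟨insert x (insert (c - x) T), ?_, ?_⟩
  · rw [card_insert_of_notMem hxy, card_insert_of_notMem hy]; omega
  · rw [sum_insert hxy, sum_insert hy, hc]; ring

open Finset in
lemma exists_sum {F : Type*} [Field F] [Fintype F] [DecidableEq F] (n : ℕ) (b : F)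
    (h1 : 3 ≤ n) (h2 : n + 3 ≤ Fintype.card F) : ∃ T : Finset F, #T = n ∧ ∑ x ∈ T, x = b := by
  by_cases h : 2 * n ≤ Fintype.card F
  · exact exists_sum_small n b h1 h
  · obtain ⟨T, hT, hTb⟩ := exists_sum_small (F := F) (Fintype.card F - n) (∑ x, x - b)
      (by omega) (by omega)
    refine ⟨Tᶜ, by rw [card_compl]; omega, ?_⟩
    have := Finset.sum_add_sum_compl T (fun x => x)
    rw [hTb] at this
    linear_combination this

open Finset Polynomial in
lemma vanish {F : Type*} [Field F] [Fintype F] [DecidableEq F] (f : F → F) (t : ℕ)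
    (hs : #{x | f x ≠ 0} ≤ t) (h : ∀ i < t, ∑ x, f x * x ^ i = 0) : f = 0 := by
  by_contra hf
  obtain ⟨x, hx⟩ := Function.ne_iff.1 hf
  simp only [Pi.zero_apply] at hx
  set S : Finset F := {x | f x ≠ 0} with hS
  have hxS : x ∈ S := by simpa [hS] using hx
  set P : F[X] := ∏ y ∈ S.erase x, (X - C y) with hP
  have hdeg : P.natDegree < t := by
    rw [hP, natDegree_prod_of_monic _ _ (fun i _ => monic_X_sub_C i)]
    simp only [natDegree_X_sub_C, sum_const, smul_eq_mul, mul_one]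
    rw [card_erase_of_mem hxS]
    have := Finset.card_pos.2 ⟨x, hxS⟩
    omega
  have h0 : ∑ y, f y * P.eval y = 0 := by
    simp_rw [eval_eq_sum_range' hdeg, mul_sum]
    rw [sum_comm]
    apply sum_eq_zero
    intro i hi
    have := h i (mem_range.1 hi)
    calc ∑ y, f y * (P.coeff i * y ^ i) = P.coeff i * ∑ y, f y * y ^ i := by
          rw [mul_sum]; exact sum_congr rfl fun _ _ => by ring
      _ = 0 := by rw [this, mul_zero]
  rw [sum_eq_single x] at h0
  · rcases mul_eq_zero.1 h0 with h1 | h1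
    · exact hx h1
    · rw [hP, eval_prod, prod_eq_zero_iff] at h1
      obtain ⟨y, hy, hy'⟩ := h1
      simp only [eval_sub, eval_X, eval_C] at hy'
      exact (mem_erase.1 hy).1 (sub_eq_zero.1 hy').symm
  · intro y _ hyx
    by_cases hy : f y = 0
    · simp [hy]
    · have : P.eval y = 0 := by
        rw [hP, eval_prod, prod_eq_zero_iff]
        exact ⟨y, mem_erase.2 ⟨hyx, by simpa [hS] using hy⟩, by simp⟩
      rw [this, mul_zero]
  · simp

open Finset in
/-- Lagrange weights -/
def lagw {F : Type*} [Field F] [DecidableEq F] (S : Finset F) (x : F) : F :=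
  if x ∈ S then (∏ y ∈ S.erase x, (x - y))⁻¹ else 0

open Finset in
lemma lagw_ne {F : Type*} [Field F] [DecidableEq F] (S : Finset F) (x : F) :
    lagw S x ≠ 0 ↔ x ∈ S := by
  unfold lagw
  split_ifs with h
  · simp only [h, iff_true]
    apply inv_ne_zero
    rw [prod_ne_zero_iff]
    intro y hy
    exact sub_ne_zero.2 (mem_erase.1 hy).1.symm
  · simp [h]

open Finset Polynomial in
lemma lagw_poly {F : Type*} [Field F] [Fintype F] [DecidableEq F] (S : Finset F) (P : F[X])
    (hP : P.degree < #S) : ∑ x, lagw S x * P.eval x = P.coeff (#S - 1) := by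
  rw [Lagrange.coeff_eq_sum (v := id) (s := S) (fun _ _ _ _ h => h) hP]
  unfold lagw
  simp only [ite_mul, zero_mul, sum_ite_mem, univ_inter, id]
  exact sum_congr rfl fun x _ => by rw [div_eq_mul_inv, mul_comm]

open Finset Polynomial in
lemma lagw_lt {F : Type*} [Field F] [Fintype F] [DecidableEq F] (S : Finset F) (i : ℕ)
    (hi : i < #S) : ∑ x, lagw S x * x ^ i = if i = #S - 1 then 1 else 0 := by
  have := lagw_poly S (X ^ i) (by rw [degree_X_pow]; exact_mod_cast hi)
  simp only [eval_pow, eval_X, coeff_X_pow] at this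
  rw [this]; simp only [eq_comm]

open Finset Polynomial in
lemma lagw_eq {F : Type*} [Field F] [Fintype F] [DecidableEq F] (S : Finset F)
    (hi : 0 < #S) : ∑ x, lagw S x * x ^ #S = ∑ x ∈ S, x := by
  have hm : (∏ y ∈ S, (X - C y) : F[X]).Monic := monic_prod_of_monic _ _ fun i _ => monic_X_sub_C i
  have hd : (∏ y ∈ S, (X - C y) : F[X]).degree = #S := by
    rw [degree_prod]; simp
  have hlt : (X ^ #S - ∏ y ∈ S, (X - C y) : F[X]).degree < #S := by
    have := degree_sub_lt_left (p := (X ^ #S : F[X])) (q := ∏ y ∈ S, (X - C y))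
      (by rw [hd, degree_X_pow]) (pow_ne_zero _ X_ne_zero) (by rw [hm.leadingCoeff]; simp)
    rwa [degree_X_pow] at this
  have := lagw_poly S _ hlt
  rw [coeff_sub, prod_X_sub_C_coeff_card_pred S (fun y => y) hi, coeff_X_pow,
    if_neg (by omega), zero_sub, neg_neg] at this
  rw [← this]
  refine sum_congr rfl fun x _ => ?_
  by_cases hx : x ∈ S
  · have : (∏ y ∈ S, (X - C y) : F[X]).eval x = 0 := by
      rw [eval_prod, prod_eq_zero_iff]; exact ⟨x, hx, by simp⟩
    rw [eval_sub, this]; simp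
  · have : lagw S x = 0 := by simp [lagw, hx]
    simp [this]

open Finset in
/-- dual condition for a triple -/
def IsD {F : Type*} [Field F] [Fintype F] (k : ℕ) (a : Matrix (Fin 2) (Fin 2) F)
    (t : (F → F) × F × F) : Prop :=
  ∀ i < k, ∑ x, t.1 x * x ^ i + (if i = k - 2 then a 0 0 * t.2.1 + a 0 1 * t.2.2 else
    if i = k - 1 then a 1 0 * t.2.1 + a 1 1 * t.2.2 else 0) = 0

open Finset in
/-- weight of a triple -/
def wtT {F : Type*} [Field F] [Fintype F] [DecidableEq F] (t : (F → F) × F × F) : ℕ :=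
  #{x | t.1 x ≠ 0} + (if t.2.1 = 0 then 0 else 1) + (if t.2.2 = 0 then 0 else 1)

open Finset in
/-- the candidate word -/
def cand {F : Type*} [Field F] [DecidableEq F] (a : Matrix (Fin 2) (Fin 2) F)
    (S : Finset F) (l : F) : (F → F) × F × F :=
  (fun x => l * lagw S x, -l * (a 1 1 - a 0 1 * ∑ x ∈ S, x) / a.det,
    -l * (a 0 0 * ∑ x ∈ S, x - a 1 0) / a.det)

open Finset in
lemma cand_supp {F : Type*} [Field F] [Fintype F] [DecidableEq F] (a : Matrix (Fin 2) (Fin 2) F)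
    (S : Finset F) (l : F) (hl : l ≠ 0) : ({x | (cand a S l).1 x ≠ 0} : Finset F) = S := by
  ext x
  have := lagw_ne S x
  simp only [ne_eq] at this
  simp [cand, hl, this]

open Finset in
lemma cand_dual {F : Type*} [Field F] [Fintype F] [DecidableEq F] (a : Matrix (Fin 2) (Fin 2) F)
    (ha : a.det ≠ 0) (k : ℕ) (hk : 2 ≤ k) (S : Finset F) (hS : #S = k - 1) (l : F) :
    IsD k a (cand a S l) := by
  have hdet := Matrix.det_fin_two a
  intro i hi
  simp only [cand]
  simp_rw [mul_assoc]
  rw [← mul_sum]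
  by_cases h : i < k - 1
  · rw [lagw_lt S i (by omega)]
    by_cases h2 : i = k - 2
    · rw [if_pos (by omega), if_pos h2]
      field_simp
      rw [hdet]; ring
    · rw [if_neg (by omega), if_neg h2, if_neg (by omega)]; ring
  · have : i = #S := by omega
    rw [if_neg (by omega), if_pos (by omega), this, lagw_eq S (by omega)]
    field_simp
    rw [hdet]; ring

open Finset in
lemma cand_wt {F : Type*} [Field F] [Fintype F] [DecidableEq F] (a : Matrix (Fin 2) (Fin 2) F)
    (ha : a.det ≠ 0) (k : ℕ) (S : Finset F) (hS : #S = k - 1) (l : F) (hl : l ≠ 0) :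
    wtT (cand a S l) = k - 1 + (if a 0 1 * ∑ x ∈ S, x = a 1 1 then 0 else 1) +
      (if a 0 0 * ∑ x ∈ S, x = a 1 0 then 0 else 1) := by
  unfold wtT
  rw [cand_supp a S l hl, hS]
  have e1 : (cand a S l).2.1 = 0 ↔ a 0 1 * ∑ x ∈ S, x = a 1 1 := by
    rw [eq_comm (a := a 0 1 * _)]
    simp [cand, hl, ha, sub_eq_zero]
  have e2 : (cand a S l).2.2 = 0 ↔ a 0 0 * ∑ x ∈ S, x = a 1 0 := by
    simp [cand, hl, ha, sub_eq_zero]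
  simp only [e1, e2]

lemma not_both {F : Type*} [Field F] (a : Matrix (Fin 2) (Fin 2) F)
    (ha : a.det ≠ 0) (s : F) (h1 : a 0 1 * s = a 1 1) (h2 : a 0 0 * s = a 1 0) : False := by
  apply ha
  rw [Matrix.det_fin_two, ← h1, ← h2]; ring

lemma solve2 {F : Type*} [Field F] (a : Matrix (Fin 2) (Fin 2) F)
    (ha : a.det ≠ 0) (u v r s : F) (h1 : r + (a 0 0 * u + a 0 1 * v) = 0)
    (h2 : s + (a 1 0 * u + a 1 1 * v) = 0) :
    u = - (a 1 1 * r - a 0 1 * s) / a.det ∧ v = - (a 0 0 * s - a 1 0 * r) / a.det := by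
  have hdet := Matrix.det_fin_two a
  constructor
  · rw [eq_div_iff ha, hdet]; linear_combination a 1 1 * h1 - a 0 1 * h2
  · rw [eq_div_iff ha, hdet]; linear_combination a 0 0 * h2 - a 1 0 * h1

open Finset in
lemma dual_struct {F : Type*} [Field F] [Fintype F] [DecidableEq F] (a : Matrix (Fin 2) (Fin 2) F)
    (ha : a.det ≠ 0) (k : ℕ) (hk : 2 ≤ k) (t : (F → F) × F × F) (ht : t ≠ 0) (hD : IsD k a t)
    (hw : wtT t ≤ k) : ∃ S : Finset F, ∃ l : F, #S = k - 1 ∧ l ≠ 0 ∧ t = cand a S l := by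
  obtain ⟨f, u, v⟩ := t
  unfold IsD at hD
  unfold wtT at hw
  simp only at hD hw
  have hlow : ∀ i < k - 2, ∑ x, f x * x ^ i = 0 := by
    intro i hi
    have := hD i (by omega)
    rwa [if_neg (by omega), if_neg (by omega), add_zero] at this
  have hm2 := hD (k - 2) (by omega)
  have hm1 := hD (k - 1) (by omega)
  rw [if_pos rfl] at hm2
  rw [if_neg (by omega), if_pos rfl] at hm1
  obtain ⟨hu, hv⟩ := solve2 a ha _ _ _ _ hm2 hm1
  have hf : f ≠ 0 := by
    rintro rfl
    apply ht
    simp only [Pi.zero_apply, zero_mul, sum_const_zero, mul_zero, sub_zero, neg_zero, zero_div] at hu hv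
    rw [hu, hv]; rfl
  have hge : k - 1 ≤ #{x | f x ≠ 0} := by
    by_contra h
    exact hf (vanish f (k - 2) (by omega) hlow)
  have hS : #{x | f x ≠ 0} = k - 1 := by
    by_contra h
    have hu0 : u = 0 := by by_contra h'; rw [if_neg h'] at hw; omega
    have hv0 : v = 0 := by by_contra h'; rw [if_neg h'] at hw; omega
    apply hf
    apply vanish f k (by omega)
    intro i hi
    have := hD i hi
    simpa [hu0, hv0] using this
  set S : Finset F := {x | f x ≠ 0} with hSdef
  set l := ∑ x, f x * x ^ (k - 2) with hl
  have hfl : f = fun x => l * lagw S x := by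
    have : (fun x => f x - l * lagw S x) = 0 := by
      apply vanish _ (k - 1)
      · rw [← hS]
        apply card_le_card
        intro x hx
        by_contra hxS
        have h1 : lagw S x = 0 := by
          by_contra h; exact hxS ((lagw_ne S x).1 h)
        have h2 : f x = 0 := by simpa [hSdef] using hxS
        simp [h1, h2] at hx
      · intro i hi
        simp_rw [sub_mul, mul_assoc]
        rw [sum_sub_distrib, ← mul_sum, lagw_lt S i (by omega), hS]
        split_ifs with h
        · have : i = k - 2 := by omega
          rw [this, hl]; ring
        · rw [hlow i (by omega)]; ring
    funext x
    exact sub_eq_zero.1 (congrFun this x)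
  have hl0 : l ≠ 0 := by
    intro h
    apply hf; rw [hfl, h]; funext x; simp
  refine ⟨S, l, hS, hl0, ?_⟩
  have hs : ∑ x, f x * x ^ (k - 1) = l * ∑ x ∈ S, x := by
    rw [← lagw_eq S (by omega), hS, mul_sum]
    refine sum_congr rfl fun x _ => ?_
    rw [congrFun hfl x]; ring
  rw [hs] at hu hv
  unfold cand
  refine Prod.ext hfl (Prod.ext ?_ ?_)
  · simp only; rw [hu]; ring
  · simp only; rw [hv]; ring

open Finset in
lemma dual_min {F : Type*} [Field F] [Fintype F] [DecidableEq F] (a : Matrix (Fin 2) (Fin 2) F)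
    (ha : a.det ≠ 0) (k : ℕ) (hk : 2 ≤ k) (t : (F → F) × F × F) (ht : t ≠ 0) (hD : IsD k a t) :
    k ≤ wtT t := by
  by_contra h
  obtain ⟨S, l, hS, hl, rfl⟩ := dual_struct a ha k hk t ht hD (by omega)
  rw [cand_wt a ha k S hS l hl] at h
  have := not_both a ha (∑ x ∈ S, x)
  split_ifs at h with h1 h2 <;> first | omega | exact this h1 h2

open Finset in
lemma dual_count {F : Type*} [Field F] [Fintype F] [DecidableEq F] (a : Matrix (Fin 2) (Fin 2) F)
    (ha : a.det ≠ 0) (k : ℕ) (hk : 2 ≤ k) :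
    {t : (F → F) × F × F | IsD k a t ∧ wtT t = k}.ncard = (Fintype.card F - 1) *
      (#{S ∈ (univ : Finset F).powersetCard (k - 1) | a 0 1 * ∑ x ∈ S, x = a 1 1} +
      #{S ∈ (univ : Finset F).powersetCard (k - 1) | a 0 0 * ∑ x ∈ S, x = a 1 0}) := by
  rw [← card_union_of_disjoint, ← filter_or]
  · set G : Finset (Finset F) := {S ∈ (univ : Finset F).powersetCard (k - 1) |
      a 0 1 * ∑ x ∈ S, x = a 1 1 ∨ a 0 0 * ∑ x ∈ S, x = a 1 0} with hG
    have himg : {t : (F → F) × F × F | IsD k a t ∧ wtT t = k} =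
        (fun z : F × Finset F => cand a z.2 z.1) '' ((univ.erase (0 : F) ×ˢ G : Finset (F × Finset F)) : Set (F × Finset F)) := by
      ext t
      simp only [Set.mem_ofPred_eq, Set.mem_image, mem_coe, mem_product, mem_erase, mem_univ, and_true,
        hG, mem_filter, mem_powersetCard_univ, Prod.exists]
      constructor
      · rintro ⟨hD, hw⟩
        have ht : t ≠ 0 := by
          rintro rfl
          simp [wtT] at hw; omega
        obtain ⟨S, l, hS, hl, rfl⟩ := dual_struct a ha k hk t ht hD (by omega)
        refine ⟨l, S, ⟨hl, hS, ?_⟩, rfl⟩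
        rw [cand_wt a ha k S hS l hl] at hw
        split_ifs at hw with h1 h2
        · exact Or.inl h1
        · exact Or.inl h1
        · right; assumption
        · omega
      · rintro ⟨l, S, ⟨hl, hS, hor⟩, rfl⟩
        refine ⟨cand_dual a ha k hk S hS l, ?_⟩
        rw [cand_wt a ha k S hS l hl]
        have := not_both a ha (∑ x ∈ S, x)
        split_ifs with h1 h2 h2
        · exact (this h1 h2).elim
        · omega
        · omega
        · tauto
    rw [himg, Set.ncard_image_of_injOn, Set.ncard_coe_finset, card_product, card_erase_of_mem (mem_univ _), card_univ]
    rintro ⟨l, S⟩ h1 ⟨l', S'⟩ h2 h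
    simp only [mem_coe, mem_product, mem_erase, mem_univ, and_true, hG, mem_filter,
      mem_powersetCard_univ] at h1 h2 h
    have hSS : S = S' := by
      rw [← cand_supp a S l h1.1, ← cand_supp a S' l' h2.1, h]
    subst hSS
    obtain ⟨x, hx⟩ := Finset.card_pos.1 (show 0 < #S by omega)
    have h3 := congrFun (congrArg Prod.fst h) x
    simp only [cand] at h3
    rw [mul_right_cancel₀ ((lagw_ne S x).2 hx) h3]
  · rw [Finset.disjoint_filter]
    intro S _ h1 h2
    exact not_both a ha _ h1 h2

open Finset in
/-- splitting a word into a triple -/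
def splitE {F : Type*} {q : ℕ} (α : Fin q ≃ F) : (Fin (q + 2) → F) ≃ (F → F) × F × F where
  toFun c := (fun x => c (α.symm x).castSucc.castSucc, c (Fin.last q).castSucc, c (Fin.last (q + 1)))
  invFun t := Fin.snoc (α := fun _ => F) (Fin.snoc (α := fun _ => F) (fun j => t.1 (α j)) t.2.1) t.2.2
  left_inv c := by
    funext j
    refine Fin.lastCases ?_ (fun j => ?_) j
    · simp
    · refine Fin.lastCases ?_ (fun j => ?_) j <;> simp
  right_inv t := by
    obtain ⟨f, u, v⟩ := t
    simp

open Finset in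
lemma split_wt {F : Type*} [Field F] [Fintype F] [DecidableEq F] {q : ℕ} (α : Fin q ≃ F)
    (c : Fin (q + 2) → F) : wtT (splitE α c) = hammingNorm c := by
  unfold wtT hammingNorm splitE
  simp only [Finset.card_filter, Equiv.coe_fn_mk]
  rw [Fin.sum_univ_castSucc, Fin.sum_univ_castSucc]
  rw [← Equiv.sum_comp α]
  simp

open Finset in
lemma split_dual {F : Type*} [Field F] [Fintype F] [DecidableEq F] {q k : ℕ} (α : Fin q ≃ F)
    (a : Matrix (Fin 2) (Fin 2) F)
    (G₃ : Matrix (Fin k) (Fin (q + 2)) F)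
    (hGv : ∀ (i : Fin k) (j : Fin (q + 2)) (h : (j : ℕ) < q),
      G₃ i j = α ⟨j, h⟩ ^ (i : ℕ))
    (hGc1 : ∀ (i : Fin k) (j : Fin (q + 2)), (j : ℕ) = q →
      G₃ i j = if (i : ℕ) = k - 2 then a 0 0 else if (i : ℕ) = k - 1 then a 1 0 else 0)
    (hGc2 : ∀ (i : Fin k) (j : Fin (q + 2)), (j : ℕ) = q + 1 →
      G₃ i j = if (i : ℕ) = k - 2 then a 0 1 else if (i : ℕ) = k - 1 then a 1 1 else 0)
    (c : Fin (q + 2) → F) :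
    (∀ y : Fin (q + 2) → F, (∃ x : Fin k → F, y = Matrix.vecMul x G₃) →
          ∑ i, c i * y i = 0) ↔ IsD k a (splitE α c) := by
  have h1 : (∀ y : Fin (q + 2) → F, (∃ x : Fin k → F, y = Matrix.vecMul x G₃) →
          ∑ i, c i * y i = 0) ↔ ∀ i : Fin k, ∑ j, c j * G₃ i j = 0 := by
    constructor
    · intro h i
      refine h (G₃ i) ⟨Pi.single i 1, ?_⟩
      rw [Matrix.single_one_vecMul]; rfl
    · rintro h y ⟨x, rfl⟩
      simp only [Matrix.vecMul, dotProduct, mul_sum]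
      rw [sum_comm]
      apply sum_eq_zero
      intro i _
      calc ∑ j, c j * (x i * G₃ i j) = x i * ∑ j, c j * G₃ i j := by
            rw [mul_sum]; exact sum_congr rfl fun _ _ => by ring
        _ = 0 := by rw [h i, mul_zero]
  rw [h1]
  have key : ∀ i : Fin k, ∑ j, c j * G₃ i j = ∑ x, (splitE α c).1 x * x ^ (i : ℕ) +
      (if (i : ℕ) = k - 2 then a 0 0 * (splitE α c).2.1 + a 0 1 * (splitE α c).2.2 else
      if (i : ℕ) = k - 1 then a 1 0 * (splitE α c).2.1 + a 1 1 * (splitE α c).2.2 else 0) := by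
    intro i
    rw [Fin.sum_univ_castSucc, Fin.sum_univ_castSucc, ← Equiv.sum_comp α, add_assoc]
    congr 1
    · refine sum_congr rfl fun j _ => ?_
      rw [hGv i _ (by simp)]
      simp [splitE]
    · rw [hGc1 i _ (by simp), hGc2 i _ (by simp)]
      simp only [splitE, Equiv.coe_fn_mk]
      split_ifs <;> ring
  unfold IsD
  constructor
  · intro h i hi
    rw [← key ⟨i, hi⟩]; exact h _
  · intro h i
    rw [key i]; exact h i i.2

open Finset in
lemma cnt_ne {F : Type*} [Field F] [Fintype F] [DecidableEq F] (n : ℕ) (b c : F) (hb : b ≠ 0) :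
    #{S ∈ (univ : Finset F).powersetCard n | b * ∑ x ∈ S, x = c} = nsum F n (c / b) := by
  unfold nsum
  congr 1
  refine filter_congr fun S _ => ?_
  rw [eq_div_iff hb, mul_comm]

open Finset in
lemma cnt_zero {F : Type*} [Field F] [Fintype F] [DecidableEq F] (n : ℕ) (c : F) (hc : c ≠ 0) :
    #{S ∈ (univ : Finset F).powersetCard n | 0 * ∑ x ∈ S, x = c} = 0 := by
  rw [card_eq_zero, filter_eq_empty_iff]
  intro S _ h
  exact hc (by rw [← h, zero_mul])

/-- over the full field, when p divides k-1, the dual distance is k and the number of weight-k dual codewords is given by a four-case formula depending on the zero pattern of M. -/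
theorem stmt12 (p m q k : ℕ) (hp : p.Prime) (hm : 0 < m) (hq : q = p ^ m)
    (F : Type*) [Field F] [Fintype F] [DecidableEq F] (hF : Fintype.card F = q)
    (hrange : (p = 2 ∧ 4 ≤ k ∧ k ≤ q - 2) ∨ (Odd p ∧ 3 ≤ k ∧ k ≤ q))
    (hd : p ∣ (k - 1))
    (α : Fin q → F) (hα : Function.Bijective α)
    (a : Matrix (Fin 2) (Fin 2) F) (ha : IsUnit a.det)
    (G₃ : Matrix (Fin k) (Fin (q + 2)) F)
    (hGv : ∀ (i : Fin k) (j : Fin (q + 2)) (h : (j : ℕ) < q),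
      G₃ i j = α ⟨j, h⟩ ^ (i : ℕ))
    (hGc1 : ∀ (i : Fin k) (j : Fin (q + 2)), (j : ℕ) = q →
      G₃ i j = if (i : ℕ) = k - 2 then a 0 0 else if (i : ℕ) = k - 1 then a 1 0 else 0)
    (hGc2 : ∀ (i : Fin k) (j : Fin (q + 2)), (j : ℕ) = q + 1 →
      G₃ i j = if (i : ℕ) = k - 2 then a 0 1 else if (i : ℕ) = k - 1 then a 1 1 else 0) :
    -- the minimum distance of the dual code is k
    ((∃ c : Fin (q + 2) → F,
        (∀ y : Fin (q + 2) → F, (∃ x : Fin k → F, y = Matrix.vecMul x G₃) →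
          ∑ i, c i * y i = 0) ∧ c ≠ 0 ∧ hammingNorm c = k) ∧
      (∀ c : Fin (q + 2) → F,
        (∀ y : Fin (q + 2) → F, (∃ x : Fin k → F, y = Matrix.vecMul x G₃) →
          ∑ i, c i * y i = 0) → c ≠ 0 → k ≤ hammingNorm c)) ∧
    (a 0 0 * a 0 1 * a 1 0 * a 1 1 ≠ 0 →
      ({c : Fin (q + 2) → F |
        (∀ y : Fin (q + 2) → F, (∃ x : Fin k → F, y = Matrix.vecMul x G₃) →
          ∑ i, c i * y i = 0) ∧ hammingNorm c = k}.ncard : ℚ) =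
        2 * ((q : ℚ) - 1) / q * ((q.choose (k - 1) : ℕ) : ℚ) +
          (-1 : ℚ) ^ (k + (k - 1) / p) * (2 * ((q : ℚ) - 1) / q) * (((q / p).choose ((k - 1) / p) : ℕ) : ℚ)) ∧
    ((a 0 0 * a 0 1 * a 1 0 ≠ 0 ∧ a 1 1 = 0) ∨ (a 0 0 * a 0 1 * a 1 1 ≠ 0 ∧ a 1 0 = 0) →
      ({c : Fin (q + 2) → F |
        (∀ y : Fin (q + 2) → F, (∃ x : Fin k → F, y = Matrix.vecMul x G₃) →
          ∑ i, c i * y i = 0) ∧ hammingNorm c = k}.ncard : ℚ) =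
        2 * ((q : ℚ) - 1) / q * ((q.choose (k - 1) : ℕ) : ℚ) +
          (-1 : ℚ) ^ (k - 1 + (k - 1) / p) * (((q : ℚ) - 1) * ((q : ℚ) - 2) / q) * (((q / p).choose ((k - 1) / p) : ℕ) : ℚ)) ∧
    ((a 0 0 * a 1 0 * a 1 1 ≠ 0 ∧ a 0 1 = 0) ∨ (a 0 1 * a 1 0 * a 1 1 ≠ 0 ∧ a 0 0 = 0) →
      ({c : Fin (q + 2) → F |
        (∀ y : Fin (q + 2) → F, (∃ x : Fin k → F, y = Matrix.vecMul x G₃) →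
          ∑ i, c i * y i = 0) ∧ hammingNorm c = k}.ncard : ℚ) =
        ((q : ℚ) - 1) / q * ((q.choose (k - 1) : ℕ) : ℚ) +
          (-1 : ℚ) ^ (k + (k - 1) / p) * (((q : ℚ) - 1) / q) * (((q / p).choose ((k - 1) / p) : ℕ) : ℚ)) ∧
    ((a 0 1 * a 1 0 ≠ 0 ∧ a 0 0 = 0 ∧ a 1 1 = 0) ∨ (a 0 0 * a 1 1 ≠ 0 ∧ a 0 1 = 0 ∧ a 1 0 = 0) →
      ({c : Fin (q + 2) → F |
        (∀ y : Fin (q + 2) → F, (∃ x : Fin k → F, y = Matrix.vecMul x G₃) →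
          ∑ i, c i * y i = 0) ∧ hammingNorm c = k}.ncard : ℚ) =
        ((q : ℚ) - 1) / q * ((q.choose (k - 1) : ℕ) : ℚ) +
          (-1 : ℚ) ^ (k - 1 + (k - 1) / p) * (((q : ℚ) - 1) ^ 2 / q) * (((q / p).choose ((k - 1) / p) : ℕ) : ℚ)) := by
  have hdet : a.det ≠ 0 := ha.ne_zero
  have hdet2 := hdet
  rw [Matrix.det_fin_two] at hdet2
  have hk : 2 ≤ k := by omega
  have : Fact p.Prime := ⟨hp⟩
  have : CharP F p := charP_of_card_eq_prime_pow (f := m) (by rw [hF, hq])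
  have hpq : p ∣ q := by rw [hq]; exact dvd_pow_self p hm.ne'
  have hn3 : 3 ≤ k - 1 ∧ (k - 1) + 3 ≤ Fintype.card F := by
    rw [hF]
    rcases hrange with ⟨h2, h3, h4⟩ | ⟨h2, h3, h4⟩
    · omega
    · have hp3 : 3 ≤ p := by
        have := hp.two_le
        rcases h2 with ⟨r, hr⟩
        omega
      have e1 := Nat.le_of_dvd (by omega) hd
      have e2 := Nat.le_of_dvd (by omega) (Nat.dvd_sub hpq hd)
      omega
  let e : Fin q ≃ F := Equiv.ofBijective α hα
  have hdual := split_dual e a G₃ hGv hGc1 hGc2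
  have hncard : {c : Fin (q + 2) → F |
        (∀ y : Fin (q + 2) → F, (∃ x : Fin k → F, y = Matrix.vecMul x G₃) →
          ∑ i, c i * y i = 0) ∧ hammingNorm c = k}.ncard =
      {t : (F → F) × F × F | IsD k a t ∧ wtT t = k}.ncard := by
    rw [← Set.ncard_image_of_injective _ (splitE e).injective]
    congr 1
    ext t
    simp only [Set.mem_image, Set.mem_ofPred_eq]
    constructor
    · rintro ⟨c, ⟨h1, h2⟩, rfl⟩
      exact ⟨(hdual c).1 h1, by rw [split_wt, h2]⟩
    · rintro ⟨h1, h2⟩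
      obtain ⟨c, rfl⟩ := (splitE e).surjective t
      exact ⟨c, ⟨(hdual c).2 h1, by rw [← split_wt e, h2]⟩, rfl⟩
  have hcount := dual_count a hdet k hk
  obtain ⟨hN1, hN0⟩ := nsum_formula (F := F) p hp (k - 1) hd
  rw [hncard, hcount, hF]
  rw [hF] at hN0
  simp only [hF] at hN1
  have hq1 : 1 ≤ q := by omega
  have hpk : (-1 : ℚ) ^ (k + (k - 1) / p) = - (-1 : ℚ) ^ (k - 1 + (k - 1) / p) := by
    have : k + (k - 1) / p = (k - 1 + (k - 1) / p) + 1 := by omega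
    rw [this, pow_succ]; ring
  have hq0 : (q : ℚ) ≠ 0 := by exact_mod_cast (by omega : q ≠ 0)
  refine ⟨⟨?_, ?_⟩, ?_, ?_, ?_, ?_⟩
  · obtain ⟨S, hS, hor⟩ : ∃ S : Finset F, S.card = k - 1 ∧
        (a 0 1 * ∑ x ∈ S, x = a 1 1 ∨ a 0 0 * ∑ x ∈ S, x = a 1 0) := by
      by_cases h0 : a 0 0 = 0
      · have h1 : a 0 1 ≠ 0 := by
          intro h; apply hdet2; rw [h0, h]; ring
        obtain ⟨S, hS, hb⟩ := exists_sum (k - 1) (a 1 1 / a 0 1) hn3.1 hn3.2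
        exact ⟨S, hS, Or.inl (by rw [hb]; field_simp)⟩
      · obtain ⟨S, hS, hb⟩ := exists_sum (k - 1) (a 1 0 / a 0 0) hn3.1 hn3.2
        exact ⟨S, hS, Or.inr (by rw [hb]; field_simp)⟩
    obtain ⟨c, hc⟩ := (splitE e).surjective (cand a S 1)
    have hw : hammingNorm c = k := by
      rw [← split_wt e, hc, cand_wt a hdet k S hS 1 one_ne_zero]
      have := not_both a hdet (∑ x ∈ S, x)
      split_ifs with h1 h2 h2
      · exact (this h1 h2).elim
      · omega
      · omega
      · tauto
    refine ⟨c, (hdual c).2 ?_, ?_, hw⟩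
    · rw [hc]; exact cand_dual a hdet k hk S hS 1
    · rintro rfl
      simp at hw; omega
  · intro c hc hc0
    rw [← split_wt e]
    refine dual_min a hdet k hk _ ?_ ((hdual c).1 hc)
    intro h
    apply hc0
    apply (splitE e).injective
    rw [h]; rfl
  · intro h
    simp only [mul_ne_zero_iff] at h
    obtain ⟨⟨⟨h00, h01⟩, h10⟩, h11⟩ := h
    rw [cnt_ne _ _ _ h01, cnt_ne _ _ _ h00]
    push_cast [Nat.cast_sub hq1]
    rw [hN1 _ (div_ne_zero h11 h01), hN1 _ (div_ne_zero h10 h00), hpk]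
    field_simp
    ring
  · rintro (⟨h, hz⟩ | ⟨h, hz⟩)
    · simp only [mul_ne_zero_iff] at h
      obtain ⟨⟨h00, h01⟩, h10⟩ := h
      rw [cnt_ne _ _ _ h01, cnt_ne _ _ _ h00, hz, zero_div]
      push_cast [Nat.cast_sub hq1]
      rw [hN0, hN1 _ (div_ne_zero h10 h00)]
      field_simp
      ring
    · simp only [mul_ne_zero_iff] at h
      obtain ⟨⟨h00, h01⟩, h11⟩ := h
      rw [cnt_ne _ _ _ h01, cnt_ne _ _ _ h00, hz, zero_div]
      push_cast [Nat.cast_sub hq1]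
      rw [hN0, hN1 _ (div_ne_zero h11 h01)]
      field_simp
      ring
  · rintro (⟨h, hz⟩ | ⟨h, hz⟩)
    · simp only [mul_ne_zero_iff] at h
      obtain ⟨⟨h00, h10⟩, h11⟩ := h
      rw [hz, cnt_zero _ _ h11, cnt_ne _ _ _ h00]
      push_cast [Nat.cast_sub hq1]
      rw [hN1 _ (div_ne_zero h10 h00), hpk]
      field_simp
      ring
    · simp only [mul_ne_zero_iff] at h
      obtain ⟨⟨h01, h10⟩, h11⟩ := h
      rw [hz, cnt_zero _ _ h10, cnt_ne _ _ _ h01]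
      push_cast [Nat.cast_sub hq1]
      rw [hN1 _ (div_ne_zero h11 h01), hpk]
      field_simp
      ring
  · rintro (⟨h, hz, hz'⟩ | ⟨h, hz, hz'⟩)
    · simp only [mul_ne_zero_iff] at h
      obtain ⟨h01, h10⟩ := h
      rw [hz, cnt_zero _ _ h10, cnt_ne _ _ _ h01, hz', zero_div]
      push_cast [Nat.cast_sub hq1]
      rw [hN0]
      field_simp
      ring
    · simp only [mul_ne_zero_iff] at h
      obtain ⟨h00, h11⟩ := h
      rw [hz, cnt_zero _ _ h11, cnt_ne _ _ _ h00, hz', zero_div]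
      push_cast [Nat.cast_sub hq1]
      rw [hN0]
      field_simp
      ring
end

section
/- Suppose (p = 2 and 4 ≤ k ≤ q−2) or (p odd and 3 ≤ k ≤ q). Then the code RL_k(F_q, M) is an NMDS code with parameters [q+2, k, q+2−k] over F_q: it has dimension k, its minimum distance equals q+2−k, and the minimum distance of its dual RL_k^⊥(F_q, M) equals k. Moreover, the number of codewords of Hamming weight q+2−k in RL_k(F_q, M) equals the number of codewords of Hamming weight k in RL_k^⊥(F_q, M). -/
section helpers
open Polynomial

/-- sum over a finite field with more than two elements vanishes -/
lemma rl_sum_univ {F : Type*} [Field F] [Fintype F] [DecidableEq F] (h : 2 < Fintype.card F) :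
    ∑ x : F, x = 0 := by
  have := FiniteField.sum_pow_lt_card_sub_one (K := F) 1 (by omega)
  simpa using this

/-- any proper nonempty size admits a subset with nonzero sum -/
lemma rl_exists_sum_ne {F : Type*} [Field F] [Fintype F] [DecidableEq F] (r : ℕ) (h1 : 1 ≤ r)
    (h2 : r < Fintype.card F) : ∃ T : Finset F, T.card = r ∧ ∑ x ∈ T, x ≠ 0 := by
  obtain ⟨T, -, hT⟩ := Finset.exists_subset_card_eq (s := (Finset.univ : Finset F)) (n := r)
    (by simpa using h2.le)
  by_cases h0 : ∑ x ∈ T, x = 0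
  · obtain ⟨a, ha⟩ : T.Nonempty := Finset.card_pos.mp (by omega)
    obtain ⟨b, hb⟩ : ∃ b, b ∉ T := by
      by_contra! hc
      have : T = Finset.univ := Finset.eq_univ_iff_forall.mpr hc
      rw [this, Finset.card_univ] at hT
      omega
    have hb' : b ∉ T.erase a := fun h => hb (Finset.mem_of_mem_erase h)
    refine ⟨insert b (T.erase a), ?_, ?_⟩
    · rw [Finset.card_insert_of_notMem hb', Finset.card_erase_of_mem ha]
      omega
    · rw [Finset.sum_insert hb']
      have := Finset.add_sum_erase T (fun x => x) ha
      intro h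
      have hab : a = b := by
        linear_combination this + h0 - h
      exact hb (hab ▸ ha)
  · exact ⟨T, hT, h0⟩

lemma rl_zero_small {F : Type*} [Field F] [Fintype F] [DecidableEq F] (r : ℕ) (h1 : 3 ≤ r)
    (h2 : 2 * r ≤ Fintype.card F) : ∃ T : Finset F, T.card = r ∧ ∑ x ∈ T, x = 0 := by
  obtain ⟨T, hT, hs⟩ := rl_exists_sum_ne (F := F) (r - 2) (by omega) (by omega)
  set s := ∑ x ∈ T, x with hsdef
  let B : Finset F := Finset.univ.filter (fun x => x + x = -s)
  have hB : B.card ≤ 1 := by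
    rw [Finset.card_le_one]
    intro x hx y hy
    simp only [B, Finset.mem_filter, Finset.mem_univ, true_and] at hx hy
    have h : (2 : F) * (x - y) = 0 := by linear_combination hx - hy
    rcases mul_eq_zero.mp h with h | h
    · exfalso
      apply hs
      linear_combination hx - x * h
    · exact sub_eq_zero.mp h
  have hcard : (T ∪ T.image (fun t => -s - t) ∪ B).card < Fintype.card F := by
    have a1 := Finset.card_union_le (T ∪ T.image (fun t => -s - t)) B
    have a2 := Finset.card_union_le T (T.image (fun t => -s - t))
    have a3 := Finset.card_image_le (s := T) (f := fun t => -s - t)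
    omega
  obtain ⟨x, hx⟩ : ∃ x, x ∉ (T ∪ T.image (fun t => -s - t) ∪ B) := by
    by_contra! hc
    rw [Finset.eq_univ_iff_forall.mpr hc, Finset.card_univ] at hcard
    omega
  simp only [Finset.mem_union, not_or, Finset.mem_image, not_exists, not_and] at hx
  obtain ⟨⟨hx1, hx2⟩, hx3⟩ := hx
  have hy1 : -s - x ∉ T := fun h => hx2 _ h (by ring)
  have hy2 : x ≠ -s - x := by
    intro h
    apply hx3
    simp only [B, Finset.mem_filter, Finset.mem_univ, true_and]
    linear_combination h
  have hx' : x ∉ insert (-s - x) T := by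
    simp only [Finset.mem_insert, not_or]
    exact ⟨hy2, hx1⟩
  refine ⟨insert x (insert (-s - x) T), ?_, ?_⟩
  · rw [Finset.card_insert_of_notMem hx', Finset.card_insert_of_notMem hy1]
    omega
  · rw [Finset.sum_insert hx', Finset.sum_insert hy1, ← hsdef]
    ring

lemma rl_zero {F : Type*} [Field F] [Fintype F] [DecidableEq F] (r : ℕ)
    (h : (3 ≤ r ∧ r + 3 ≤ Fintype.card F) ∨
      ((2 : F) ≠ 0 ∧ 1 ≤ r ∧ r + 1 ≤ Fintype.card F ∧ 3 ≤ Fintype.card F)) :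
    ∃ T : Finset F, T.card = r ∧ ∑ x ∈ T, x = 0 := by
  have key : ∀ r : ℕ, 2 * r ≤ Fintype.card F → (3 ≤ r ∨ ((2 : F) ≠ 0 ∧ 1 ≤ r)) →
      ∃ T : Finset F, T.card = r ∧ ∑ x ∈ T, x = 0 := by
    intro r hr h
    by_cases h3 : 3 ≤ r
    · exact rl_zero_small r h3 hr
    · rcases h with h | ⟨h, h1⟩
      · omega
      · have : r = 1 ∨ r = 2 := by omega
        rcases this with rfl | rfl
        · exact ⟨{0}, by simp, by simp⟩
        · have hne : (1 : F) ≠ -1 := by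
            intro h'
            apply h
            linear_combination h'
          refine ⟨{1, -1}, Finset.card_pair hne, ?_⟩
          rw [Finset.sum_pair hne]
          ring
  by_cases hr : 2 * r ≤ Fintype.card F
  · exact key r hr (by tauto)
  · obtain ⟨T, hT, hs⟩ := key (Fintype.card F - r) (by omega) (by
      rcases h with h | h
      · left; omega
      · right; exact ⟨h.1, by omega⟩)
    refine ⟨Tᶜ, ?_, ?_⟩
    · rw [Finset.card_compl, hT]
      rcases h with h | h <;> omega
    · have := Finset.sum_add_sum_compl T (fun x => x)
      rw [rl_sum_univ (by rcases h with h | h <;> omega)] at this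
      simpa [hs] using this

lemma rl_subset_sum {F : Type*} [Field F] [Fintype F] [DecidableEq F] (r : ℕ)
    (h : (3 ≤ r ∧ r + 3 ≤ Fintype.card F) ∨
      ((2 : F) ≠ 0 ∧ 1 ≤ r ∧ r + 1 ≤ Fintype.card F ∧ 3 ≤ Fintype.card F)) (s : F) :
    ∃ T : Finset F, T.card = r ∧ ∑ x ∈ T, x = s := by
  by_cases hs : s = 0
  · subst hs
    exact rl_zero r h
  · obtain ⟨T, hT, hu⟩ := rl_exists_sum_ne (F := F) r (by omega) (by omega)
    have hc : s / (∑ x ∈ T, x) ≠ 0 := div_ne_zero hs hu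
    refine ⟨T.image (fun x => s / (∑ x ∈ T, x) * x), ?_, ?_⟩
    · rw [Finset.card_image_of_injective _ (mul_right_injective₀ hc), hT]
    · rw [Finset.sum_image (fun x _ y _ h => mul_right_injective₀ hc h), ← Finset.mul_sum]
      field_simp

/-- equality of numbers of elements in the left and right kernels of a square matrix -/
lemma rl_ker_card {F : Type*} [Field F] [Fintype F] [DecidableEq F] {m n : Type*}
    [Fintype m] [Fintype n] [DecidableEq m] [DecidableEq n]
    (h : Fintype.card m = Fintype.card n) (A : Matrix m n F) :
    Nat.card {x : m → F // Matrix.vecMul x A = 0} = Nat.card {c : n → F // A.mulVec c = 0} := by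
  have e1 : Nat.card (LinearMap.ker A.vecMulLinear) = Nat.card (LinearMap.ker A.mulVecLin) := by
    rw [Module.natCard_eq_pow_finrank (K := F) (V := LinearMap.ker A.vecMulLinear),
      Module.natCard_eq_pow_finrank (K := F) (V := LinearMap.ker A.mulVecLin)]
    congr 1
    have a1 := LinearMap.finrank_range_add_finrank_ker A.vecMulLinear
    have a2 := LinearMap.finrank_range_add_finrank_ker A.mulVecLin
    have a3 : Module.finrank F (LinearMap.range A.vecMulLinear)
        = Module.finrank F (LinearMap.range A.mulVecLin) := by
      have := Matrix.rank_transpose A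
      rw [Matrix.rank, Matrix.rank, Matrix.mulVecLin_transpose] at this
      exact this
    rw [Module.finrank_fintype_fun_eq_card] at a1 a2
    omega
  exact e1

/-- The weight-count symmetry of NMDS codes. -/
lemma rl_nmds_count {F : Type*} [Field F] [Fintype F] [DecidableEq F] {k n : ℕ} (hkn : k < n)
    (G : Matrix (Fin k) (Fin n) F)
    (h1 : ∀ x : Fin k → F, x ≠ 0 → n - k ≤ hammingNorm (Matrix.vecMul x G))
    (h2 : ∀ c : Fin n → F, G.mulVec c = 0 → c ≠ 0 → k ≤ hammingNorm c) (hk : 0 < k) :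
    {c : Fin n → F | (∃ x : Fin k → F, c = Matrix.vecMul x G) ∧ hammingNorm c = n - k}.ncard =
      {c : Fin n → F | G.mulVec c = 0 ∧ hammingNorm c = k}.ncard := by
  classical
  have hinj : Function.Injective (fun x : Fin k → F => Matrix.vecMul x G) := by
    intro x y hxy
    by_contra hne
    have := h1 (x - y) (sub_ne_zero.mpr hne)
    rw [Matrix.sub_vecMul, sub_eq_zero.mpr hxy, hammingNorm_zero] at this
    omega
  let Z : (Fin n → F) → Finset (Fin n) := fun c => Finset.univ.filter (fun j => c j = 0)
  have hZ : ∀ c, (Z c).card + hammingNorm c = n := by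
    intro c
    have := Finset.card_filter_add_card_filter_not (s := (Finset.univ : Finset (Fin n)))
      (fun j => c j = 0)
    simpa [hammingNorm, Z] using this
  let S : (Fin n → F) → Finset (Fin n) := fun c => Finset.univ.filter (fun j => c j ≠ 0)
  have eL : {c : Fin n → F | (∃ x : Fin k → F, c = Matrix.vecMul x G) ∧
      hammingNorm c = n - k} = (fun x : Fin k → F => Matrix.vecMul x G) ''
        (↑((Finset.univ : Finset (Fin k → F)).filter
          (fun x => hammingNorm (Matrix.vecMul x G) = n - k)) : Set (Fin k → F)) := by
    ext c
    simp only [Set.mem_ofPred_eq, Set.mem_image, Finset.coe_filter, Finset.mem_univ, true_and]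
    constructor
    · rintro ⟨⟨x, rfl⟩, hx⟩
      exact ⟨x, hx, rfl⟩
    · rintro ⟨x, hx, rfl⟩
      exact ⟨⟨x, rfl⟩, hx⟩
  have eR : {c : Fin n → F | G.mulVec c = 0 ∧ hammingNorm c = k} =
      (↑((Finset.univ : Finset (Fin n → F)).filter
          (fun c => G.mulVec c = 0 ∧ hammingNorm c = k)) : Set (Fin n → F)) := by
    ext c
    simp
  rw [eL, eR, Set.ncard_image_of_injective _ hinj, Set.ncard_coe_finset, Set.ncard_coe_finset]
  rw [Finset.card_eq_sum_card_fiberwise (f := fun x => Z (Matrix.vecMul x G))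
    (t := Finset.powersetCard k Finset.univ), 
    Finset.card_eq_sum_card_fiberwise (f := S) (t := Finset.powersetCard k Finset.univ)]
  rotate_left
  · intro c hc
    simp only [Finset.coe_filter, Finset.mem_univ, true_and, Set.mem_ofPred_eq] at hc
    simp only [Finset.mem_coe, Finset.mem_powersetCard, Finset.subset_univ, true_and]
    exact hc.2
  · intro x hx
    simp only [Finset.coe_filter, Finset.mem_univ, true_and, Set.mem_ofPred_eq] at hx
    have := hZ (Matrix.vecMul x G)
    simp only [Finset.mem_coe,
      Finset.mem_powersetCard, Finset.subset_univ, true_and]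
    omega
  apply Finset.sum_congr rfl
  intro T hT
  have hTk : T.card = k := (Finset.mem_powersetCard.mp hT).2
  let A : Matrix (Fin k) T F := fun i j => G i j
  have hker := rl_ker_card (by simp [hTk]) A
  -- left
  have hl : (Finset.filter (fun x => Z (Matrix.vecMul x G) = T)
      (Finset.univ.filter (fun x => hammingNorm (Matrix.vecMul x G) = n - k))).card + 1 =
      Nat.card {x : Fin k → F // Matrix.vecMul x A = 0} := by
    rw [Nat.card_eq_fintype_card, Fintype.card_subtype]
    have h0 : (0 : Fin k → F) ∈ (Finset.univ.filter (fun x : Fin k → F => Matrix.vecMul x A = 0)) := by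
      simp
    rw [← Finset.card_erase_add_one h0]
    congr 2
    ext x
    simp only [Finset.mem_filter, Finset.mem_univ, true_and, Finset.mem_erase]
    have hA : Matrix.vecMul x A = 0 ↔ T ⊆ Z (Matrix.vecMul x G) := by
      rw [funext_iff]
      constructor
      · intro h j hj
        simp only [Z, Finset.mem_filter, Finset.mem_univ, true_and]
        exact h ⟨j, hj⟩
      · rintro h ⟨j, hj⟩
        have := h hj
        simp only [Z, Finset.mem_filter, Finset.mem_univ, true_and] at this
        exact this
    rw [hA]
    have hz := hZ (Matrix.vecMul x G)
    constructor
    · rintro ⟨hx, rfl⟩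
      refine ⟨?_, subset_rfl⟩
      rintro rfl
      rw [Matrix.zero_vecMul, hammingNorm_zero] at hx
      omega
    · rintro ⟨hx, hs⟩
      have b1 := h1 x hx
      have b2 := Finset.card_le_card hs
      refine ⟨by omega, ?_⟩
      exact (Finset.eq_of_subset_of_card_le hs (by omega)).symm
  have hr : (Finset.filter (fun c => S c = T)
      (Finset.univ.filter (fun c => G.mulVec c = 0 ∧ hammingNorm c = k))).card + 1 =
      Nat.card {c : T → F // A.mulVec c = 0} := by
    rw [Nat.card_eq_fintype_card, Fintype.card_subtype]
    have h0 : (0 : T → F) ∈ (Finset.univ.filter (fun x : T → F => A.mulVec x = 0)) := by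
      simp
    rw [← Finset.card_erase_add_one h0]
    congr 1
    have hmul : ∀ c : Fin n → F, S c ⊆ T → A.mulVec (fun j : T => c j) = G.mulVec c := by
      intro c hc
      ext i
      simp only [Matrix.mulVec, dotProduct, A]
      rw [Finset.sum_coe_sort T (fun j => G i j * c j)]
      apply Finset.sum_subset (Finset.subset_univ _)
      intro j _ hj
      have : c j = 0 := by
        by_contra hne
        exact hj (hc (by simpa [S] using hne))
      simp [this]
    refine Finset.card_bij' (fun c _ => fun j : T => c j)
      (fun c _ => fun j => if h : j ∈ T then c ⟨j, h⟩ else 0) ?_ ?_ ?_ ?_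
    · intro c hc
      simp only [Finset.mem_filter, Finset.mem_univ, true_and] at hc
      simp only [Finset.mem_filter, Finset.mem_univ, true_and, Finset.mem_erase]
      obtain ⟨⟨hc1, hc2⟩, hc3⟩ := hc
      refine ⟨?_, by rw [hmul c hc3.le, hc1]⟩
      obtain ⟨j, hj⟩ : T.Nonempty := Finset.card_pos.mp (by omega)
      intro h
      have hcj := congrFun h ⟨j, hj⟩
      rw [← hc3] at hj
      simp only [S, Finset.mem_filter] at hj
      exact hj.2 hcj
    · intro c hc
      simp only [Finset.mem_filter, Finset.mem_univ, true_and, Finset.mem_erase] at hc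
      obtain ⟨hc1, hc2⟩ := hc
      set c' : Fin n → F := fun j => if h : j ∈ T then c ⟨j, h⟩ else 0 with hc'
      have hS : S c' ⊆ T := by
        intro j hj
        by_contra hne
        simp [S, c', hne] at hj
      have hres : (fun j : T => c' j) = c := by
        ext j
        simp [c']
      have hG : G.mulVec c' = 0 := by rw [← hmul c' hS, hres, hc2]
      have hne : c' ≠ 0 := by
        intro h
        apply hc1
        rw [← hres, h]
        rfl
      have b1 : k ≤ (S c').card := h2 c' hG hne
      have b2 := Finset.card_le_card hS
      have b3 : hammingNorm c' = (S c').card := rfl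
      simp only [Finset.mem_filter, Finset.mem_univ, true_and]
      exact ⟨⟨hG, by omega⟩, Finset.eq_of_subset_of_card_le hS (by omega)⟩
    · intro c hc
      simp only [Finset.mem_filter, Finset.mem_univ, true_and] at hc
      ext j
      by_cases hj : j ∈ T
      · simp [hj]
      · simp only [hj, dite_false]
        rw [← hc.2] at hj
        simp only [S, Finset.mem_filter, Finset.mem_univ, true_and, not_not] at hj
        exact hj.symm
    · intro c hc
      ext j
      simp
  omega

/-- the primal lower bound -/
lemma rl_primal {F : Type*} [Field F] [Fintype F] [DecidableEq F] (k : ℕ) (hk : 3 ≤ k)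
    (hkq : k ≤ Fintype.card F) (P : F[X]) (hP : P ≠ 0) (hd : P.natDegree < k)
    (a : Matrix (Fin 2) (Fin 2) F) (ha : IsUnit a.det) :
    Fintype.card F + 2 - k ≤ (Finset.univ.filter (fun x : F => P.eval x ≠ 0)).card +
      (if a 0 0 * P.coeff (k - 2) + a 1 0 * P.coeff (k - 1) ≠ 0 then 1 else 0) +
      (if a 0 1 * P.coeff (k - 2) + a 1 1 * P.coeff (k - 1) ≠ 0 then 1 else 0) := by
  have h1 : (Finset.univ.filter (fun x : F => P.eval x = 0)).card ≤ P.natDegree := by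
    have : (Finset.univ.filter (fun x : F => P.eval x = 0)) ⊆ P.roots.toFinset := by
      intro x hx
      simp only [Finset.mem_filter, Finset.mem_univ, true_and] at hx
      simp [hP, hx]
    exact (Finset.card_le_card this).trans ((Multiset.toFinset_card_le _).trans (card_roots' P))
  have h2 := Finset.card_filter_add_card_filter_not (s := (Finset.univ : Finset F))
      (fun x => P.eval x = 0)
  rw [Finset.card_univ] at h2
  change _ + (Finset.univ.filter (fun x : F => P.eval x ≠ 0)).card = _ at h2
  rw [Matrix.det_fin_two] at ha
  have ha' := ha.ne_zero
  by_cases hu : P.coeff (k - 2) = 0 ∧ P.coeff (k - 1) = 0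
  · have hdk : P.natDegree + 3 ≤ k := by
      have hl : P.coeff P.natDegree ≠ 0 := by simpa using hP
      have n1 : P.natDegree ≠ k - 2 := fun h => hl (h ▸ hu.1)
      have n2 : P.natDegree ≠ k - 1 := fun h => hl (h ▸ hu.2)
      omega
    omega
  · by_cases c1 : a 0 0 * P.coeff (k - 2) + a 1 0 * P.coeff (k - 1) = 0
    · have c2 : a 0 1 * P.coeff (k - 2) + a 1 1 * P.coeff (k - 1) ≠ 0 := by
        intro c2
        apply hu
        constructor
        · apply (mul_eq_zero.mp _).resolve_left ha'
          linear_combination a 1 1 * c1 - a 1 0 * c2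
        · apply (mul_eq_zero.mp _).resolve_left ha'
          linear_combination a 0 0 * c2 - a 0 1 * c1
      rw [if_pos c2]
      omega
    · rw [if_pos c1]
      omega

/-- the dual lower bound -/
lemma rl_dual {F : Type*} [Field F] [Fintype F] [DecidableEq F] (k : ℕ) (hk : 3 ≤ k)
    (d : F → F) (u v : F) (a : Matrix (Fin 2) (Fin 2) F) (ha : IsUnit a.det)
    (h : ∀ P : F[X], P.natDegree < k → ∑ x, d x * P.eval x +
      u * (a 0 0 * P.coeff (k - 2) + a 1 0 * P.coeff (k - 1)) +
      v * (a 0 1 * P.coeff (k - 2) + a 1 1 * P.coeff (k - 1)) = 0)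
    (hw : (Finset.univ.filter (fun x : F => d x ≠ 0)).card +
      (if u ≠ 0 then 1 else 0) + (if v ≠ 0 then 1 else 0) < k) :
    d = 0 ∧ u = 0 ∧ v = 0 := by
  set S := Finset.univ.filter (fun x : F => d x ≠ 0) with hS
  rw [Matrix.det_fin_two] at ha
  have ha' := ha.ne_zero
  have huv : u = 0 ∧ v = 0 := by
    by_cases hc : S.card + 2 ≤ k
    · let P : F[X] := (∏ s ∈ S, (X - C s)) * X ^ (k - 2 - S.card)
      have hm0 : (∏ s ∈ S, (X - C s)).Monic := monic_prod_of_monic _ _ (fun s _ => monic_X_sub_C s)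
      have hm : P.Monic := hm0.mul (monic_X_pow _)
      have hdeg : P.natDegree = k - 2 := by
        rw [hm0.natDegree_mul (monic_X_pow _), natDegree_X_pow, natDegree_finsetProd_X_sub_C_eq_card]
        omega
      have hz : ∀ x, d x * P.eval x = 0 := by
        intro x
        by_cases hx : d x = 0
        · simp [hx]
        · have hx' : x ∈ S := by simp [hS, hx]
          have : (∏ s ∈ S, (X - C s)).eval x = 0 := by
            rw [eval_prod]
            exact Finset.prod_eq_zero hx' (by simp)
          simp [P, eval_mul, this]
      have c1 : P.coeff (k - 2) = 1 := by
        rw [← hdeg]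
        exact hm
      have c2 : P.coeff (k - 1) = 0 := coeff_eq_zero_of_natDegree_lt (by omega)
      have e1 := h P (by omega)
      have e2 := h (P * X) (by rw [natDegree_mul_X hm.ne_zero]; omega)
      have c3 : (P * X).coeff (k - 1) = 1 := by
        rw [show k - 1 = (k - 2) + 1 by omega, coeff_mul_X, c1]
      rw [c3] at e2
      rw [c1, c2] at e1
      simp only [hz, Finset.sum_const_zero] at e1
      have hz2 : ∀ x, d x * (P * X).eval x = 0 := by
        intro x
        rw [eval_mul, ← mul_assoc, hz, zero_mul]
      simp only [hz2, Finset.sum_const_zero] at e2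
      have f1 : u * a 0 0 + v * a 0 1 = 0 := by linear_combination e1
      have f2 : u * a 1 0 + v * a 1 1 = 0 := by
        linear_combination e2 - (P * X).coeff (k - 2) * f1
      constructor
      · apply (mul_eq_zero.mp _).resolve_left ha'
        linear_combination a 1 1 * f1 - a 0 1 * f2
      · apply (mul_eq_zero.mp _).resolve_left ha'
        linear_combination a 0 0 * f2 - a 1 0 * f1
    · constructor
      · by_contra hne
        rw [if_pos hne] at hw
        omega
      · by_contra hne
        rw [if_pos hne] at hw
        omega
  refine ⟨?_, huv⟩
  obtain ⟨rfl, rfl⟩ := huv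
  funext y
  by_contra hy
  have hy' : y ∈ S := by simpa [hS] using hy
  have e := h (∏ s ∈ S.erase y, (X - C s)) (by
    rw [natDegree_finsetProd_X_sub_C_eq_card, Finset.card_erase_of_mem hy']
    omega)
  rw [Finset.sum_eq_single y] at e
  · simp only [zero_mul, add_zero] at e
    rcases mul_eq_zero.mp e with e | e
    · exact hy e
    · rw [eval_prod, Finset.prod_eq_zero_iff] at e
      obtain ⟨s, hs, hs'⟩ := e
      simp only [eval_sub, eval_X, eval_C, sub_eq_zero] at hs'
      exact (Finset.mem_erase.mp hs).1 hs'.symm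
  · intro x _ hxy
    by_cases hx : d x = 0
    · simp [hx]
    · have hx' : x ∈ S.erase y := by simp [hS, hx, hxy]
      rw [eval_prod, Finset.prod_eq_zero hx' (by simp), mul_zero]
  · simp

/-- existence of a polynomial giving a minimum weight codeword -/
lemma rl_exists {F : Type*} [Field F] [Fintype F] [DecidableEq F] (k : ℕ) (hk : 3 ≤ k)
    (h : (3 ≤ k - 1 ∧ k - 1 + 3 ≤ Fintype.card F) ∨
      ((2 : F) ≠ 0 ∧ 1 ≤ k - 1 ∧ k - 1 + 1 ≤ Fintype.card F ∧ 3 ≤ Fintype.card F))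
    (a : Matrix (Fin 2) (Fin 2) F) (ha : IsUnit a.det) :
    ∃ P : F[X], P ≠ 0 ∧ P.natDegree < k ∧ (Finset.univ.filter (fun x : F => P.eval x ≠ 0)).card +
      (if a 0 0 * P.coeff (k - 2) + a 1 0 * P.coeff (k - 1) ≠ 0 then 1 else 0) +
      (if a 0 1 * P.coeff (k - 2) + a 1 1 * P.coeff (k - 1) ≠ 0 then 1 else 0) ≤
      Fintype.card F + 2 - k := by
  have main : ∀ s : F, ∃ P : F[X], P ≠ 0 ∧ P.natDegree < k ∧
      (Finset.univ.filter (fun x : F => P.eval x ≠ 0)).card + (k - 1) ≤ Fintype.card F ∧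
      P.coeff (k - 2) = -s ∧ P.coeff (k - 1) = 1 := by
    intro s
    obtain ⟨T, hT, hs⟩ := rl_subset_sum (k - 1) h s
    have hm : (∏ t ∈ T, (X - C t)).Monic := monic_prod_of_monic _ _ (fun s _ => monic_X_sub_C s)
    have hdeg : (∏ t ∈ T, (X - C t)).natDegree = k - 1 := by
      rw [natDegree_finsetProd_X_sub_C_eq_card, hT]
    refine ⟨∏ t ∈ T, (X - C t), hm.ne_zero, by omega, ?_, ?_, ?_⟩
    · have : (Finset.univ.filter (fun x : F => (∏ t ∈ T, (X - C t)).eval x ≠ 0)) ⊆ Tᶜ := by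
        intro x hx
        simp only [Finset.mem_filter, Finset.mem_univ, true_and] at hx
        rw [Finset.mem_compl]
        intro hxT
        apply hx
        rw [eval_prod, Finset.prod_eq_zero hxT (by simp)]
      have := Finset.card_le_card this
      rw [Finset.card_compl, hT] at this
      omega
    · have := prod_X_sub_C_coeff_card_pred T (fun t => t) (by omega)
      rw [hT, hs] at this
      exact this
    · rw [← hdeg]
      exact hm
  rw [Matrix.det_fin_two] at ha
  have ha' := ha.ne_zero
  by_cases h0 : a 0 0 = 0
  · have h1 : a 0 1 ≠ 0 := by
      intro h1
      apply ha'
      rw [h0, h1]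
      ring
    obtain ⟨P, hP, hd, hc, c1, c2⟩ := main (a 1 1 / a 0 1)
    refine ⟨P, hP, hd, ?_⟩
    have hz : a 0 1 * P.coeff (k - 2) + a 1 1 * P.coeff (k - 1) = 0 := by
      rw [c1, c2]
      field_simp
      ring
    rw [if_neg (not_not.mpr hz)]
    split_ifs <;> omega
  · obtain ⟨P, hP, hd, hc, c1, c2⟩ := main (a 1 0 / a 0 0)
    refine ⟨P, hP, hd, ?_⟩
    have hz : a 0 0 * P.coeff (k - 2) + a 1 0 * P.coeff (k - 1) = 0 := by
      rw [c1, c2]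
      field_simp
      ring
    rw [if_neg (not_not.mpr hz)]
    split_ifs <;> omega

end helpers

/-- RL_k(F_q, M) is NMDS with parameters [q+2, k, q+2-k]: dimension k, minimum distance q+2-k, dual minimum distance k, and equal numbers of minimum weight codewords in the code and its dual. -/
theorem stmt13 (p m q k : ℕ) (hp : p.Prime) (hm : 0 < m) (hq : q = p ^ m)
    (F : Type*) [Field F] [Fintype F] [DecidableEq F] (hF : Fintype.card F = q)
    (hrange : (p = 2 ∧ 4 ≤ k ∧ k ≤ q - 2) ∨ (Odd p ∧ 3 ≤ k ∧ k ≤ q))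
    (α : Fin q → F) (hα : Function.Bijective α)
    (a : Matrix (Fin 2) (Fin 2) F) (ha : IsUnit a.det)
    (G₃ : Matrix (Fin k) (Fin (q + 2)) F)
    (hGv : ∀ (i : Fin k) (j : Fin (q + 2)) (h : (j : ℕ) < q),
      G₃ i j = α ⟨j, h⟩ ^ (i : ℕ))
    (hGc1 : ∀ (i : Fin k) (j : Fin (q + 2)), (j : ℕ) = q →
      G₃ i j = if (i : ℕ) = k - 2 then a 0 0 else if (i : ℕ) = k - 1 then a 1 0 else 0)
    (hGc2 : ∀ (i : Fin k) (j : Fin (q + 2)), (j : ℕ) = q + 1 →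
      G₃ i j = if (i : ℕ) = k - 2 then a 0 1 else if (i : ℕ) = k - 1 then a 1 1 else 0) :
    -- the code has dimension k
    Module.finrank F (LinearMap.range G₃.vecMulLinear) = k ∧
    -- the minimum distance of the code is q + 2 - k
    ((∃ c : Fin (q + 2) → F, (∃ x : Fin k → F, c = Matrix.vecMul x G₃) ∧
        c ≠ 0 ∧ hammingNorm c = q + 2 - k) ∧
      (∀ c : Fin (q + 2) → F, (∃ x : Fin k → F, c = Matrix.vecMul x G₃) →
        c ≠ 0 → q + 2 - k ≤ hammingNorm c)) ∧
    -- the minimum distance of the dual code is k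
    ((∃ c : Fin (q + 2) → F,
        (∀ y : Fin (q + 2) → F, (∃ x : Fin k → F, y = Matrix.vecMul x G₃) →
          ∑ i, c i * y i = 0) ∧ c ≠ 0 ∧ hammingNorm c = k) ∧
      (∀ c : Fin (q + 2) → F,
        (∀ y : Fin (q + 2) → F, (∃ x : Fin k → F, y = Matrix.vecMul x G₃) →
          ∑ i, c i * y i = 0) → c ≠ 0 → k ≤ hammingNorm c)) ∧
    -- A_{q+2-k} = A_k^⊥
    {c : Fin (q + 2) → F | (∃ x : Fin k → F, c = Matrix.vecMul x G₃) ∧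
        hammingNorm c = q + 2 - k}.ncard =
      {c : Fin (q + 2) → F |
        (∀ y : Fin (q + 2) → F, (∃ x : Fin k → F, y = Matrix.vecMul x G₃) →
          ∑ i, c i * y i = 0) ∧ hammingNorm c = k}.ncard := by

  classical
  have hk3 : 3 ≤ k := by rcases hrange with h | h <;> omega
  have hkq : k ≤ q := by rcases hrange with h | h <;> omega
  have hcond : (3 ≤ k - 1 ∧ k - 1 + 3 ≤ Fintype.card F) ∨
      ((2 : F) ≠ 0 ∧ 1 ≤ k - 1 ∧ k - 1 + 1 ≤ Fintype.card F ∧ 3 ≤ Fintype.card F) := by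
    rw [hF]
    rcases hrange with ⟨_, h1, h2⟩ | ⟨hodd, h1, h2⟩
    · left
      omega
    · right
      refine ⟨?_, by omega, by omega, by omega⟩
      intro h20
      have hq1 : ((q : ℕ) : F) = 0 := by rw [← hF]; exact FiniteField.cast_card_eq_zero F
      have hqo : Odd q := by rw [hq]; exact hodd.pow
      obtain ⟨t, ht⟩ := hqo
      rw [ht] at hq1
      push_cast at hq1
      rw [h20] at hq1
      simp at hq1
  let αe : Fin q ≃ F := Equiv.ofBijective α hα
  -- the three kinds of columns
  have hcol : ∀ (P : Polynomial F), P.natDegree < k → ∀ j : Fin q,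
      Matrix.vecMul (fun i : Fin k => P.coeff i) G₃ j.castSucc.castSucc = P.eval (α j) := by
    intro P hP j
    rw [Polynomial.eval_eq_sum_range' hP, ← Fin.sum_univ_eq_sum_range
      (fun i => P.coeff i * α j ^ i) k]
    simp only [Matrix.vecMul, dotProduct]
    apply Finset.sum_congr rfl
    intro i _
    rw [hGv i _ (by simp)]
    rfl
  have htwo : ∀ (P : Polynomial F) (b c : F),
      ∑ i : Fin k, P.coeff i * (if (i : ℕ) = k - 2 then b else if (i : ℕ) = k - 1 then c else 0) =
        b * P.coeff (k - 2) + c * P.coeff (k - 1) := by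
    intro P b c
    rw [Fin.sum_univ_eq_sum_range
      (fun i => P.coeff i * (if i = k - 2 then b else if i = k - 1 then c else 0)) k]
    obtain ⟨r, rfl⟩ : ∃ r, k = r + 2 := ⟨k - 2, by omega⟩
    rw [Finset.sum_range_succ, Finset.sum_range_succ, Finset.sum_eq_zero]
    · simp
      ring
    · intro i hi
      have := Finset.mem_range.mp hi
      rw [if_neg (by omega), if_neg (by omega), mul_zero]
  have hc1 : ∀ (P : Polynomial F),
      Matrix.vecMul (fun i : Fin k => P.coeff i) G₃ (Fin.last q).castSucc =
        a 0 0 * P.coeff (k - 2) + a 1 0 * P.coeff (k - 1) := by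
    intro P
    rw [← htwo]
    simp only [Matrix.vecMul, dotProduct]
    apply Finset.sum_congr rfl
    intro i _
    rw [hGc1 i _ (by simp)]
  have hc2 : ∀ (P : Polynomial F),
      Matrix.vecMul (fun i : Fin k => P.coeff i) G₃ (Fin.last (q + 1)) =
        a 0 1 * P.coeff (k - 2) + a 1 1 * P.coeff (k - 1) := by
    intro P
    rw [← htwo]
    simp only [Matrix.vecMul, dotProduct]
    apply Finset.sum_congr rfl
    intro i _
    rw [hGc2 i _ (by simp)]
  have hnorm : ∀ c : Fin (q + 2) → F, hammingNorm c =
      (Finset.univ.filter (fun x : F => c (αe.symm x).castSucc.castSucc ≠ 0)).card +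
      (if c (Fin.last q).castSucc ≠ 0 then 1 else 0) +
      (if c (Fin.last (q + 1)) ≠ 0 then 1 else 0) := by
    intro c
    rw [hammingNorm, Finset.card_filter, Fin.sum_univ_castSucc, Fin.sum_univ_castSucc,
      Finset.card_filter]
    congr 2
    rw [← Equiv.sum_comp αe]
    simp
  have hα' : ∀ x, α (αe.symm x) = x := fun x => αe.apply_symm_apply x
  have hnormP : ∀ P : Polynomial F, P.natDegree < k →
      hammingNorm (Matrix.vecMul (fun i : Fin k => P.coeff i) G₃) =
      (Finset.univ.filter (fun x : F => P.eval x ≠ 0)).card +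
      (if a 0 0 * P.coeff (k - 2) + a 1 0 * P.coeff (k - 1) ≠ 0 then 1 else 0) +
      (if a 0 1 * P.coeff (k - 2) + a 1 1 * P.coeff (k - 1) ≠ 0 then 1 else 0) := by
    intro P hP
    rw [hnorm, hc1, hc2]
    simp only [hcol P hP, hα']
  have hofFn : ∀ x : Fin k → F, ∃ P : Polynomial F, P.natDegree < k ∧
      (fun i : Fin k => P.coeff i) = x := by
    intro x
    refine ⟨Polynomial.ofFn k x, Polynomial.ofFn_natDegree_lt (by omega) x, ?_⟩
    ext i
    rw [Polynomial.ofFn_coeff_eq_val_of_lt x i.2]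
  have h1 : ∀ x : Fin k → F, x ≠ 0 → q + 2 - k ≤ hammingNorm (Matrix.vecMul x G₃) := by
    intro x hx
    obtain ⟨P, hP, rfl⟩ := hofFn x
    rw [hnormP P hP, ← hF]
    apply rl_primal k hk3 (by omega) P _ hP a ha
    rintro rfl
    apply hx
    ext i
    simp
  have hdual : ∀ c : Fin (q + 2) → F,
      (∀ y : Fin (q + 2) → F, (∃ x : Fin k → F, y = Matrix.vecMul x G₃) →
          ∑ i, c i * y i = 0) ↔ G₃.mulVec c = 0 := by
    intro c
    have hd : ∀ x : Fin k → F, ∑ i, c i * Matrix.vecMul x G₃ i = x ⬝ᵥ G₃.mulVec c := by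
      intro x
      rw [Matrix.dotProduct_mulVec, dotProduct_comm]
      rfl
    constructor
    · intro h
      apply dotProduct_eq_zero _
      intro x
      rw [dotProduct_comm, ← hd]
      exact h _ ⟨x, rfl⟩
    · rintro h y ⟨x, rfl⟩
      rw [hd, h, dotProduct_zero]
  have h2 : ∀ c : Fin (q + 2) → F, G₃.mulVec c = 0 → c ≠ 0 → k ≤ hammingNorm c := by
    intro c hc hne
    by_contra hlt
    rw [hnorm] at hlt
    obtain ⟨e1, e2, e3⟩ := rl_dual k hk3 (fun x => c (αe.symm x).castSucc.castSucc)
      (c (Fin.last q).castSucc) (c (Fin.last (q + 1))) a ha (by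
        intro P hP
        have := (hdual c).mpr hc _ ⟨fun i : Fin k => P.coeff i, rfl⟩
        rw [Fin.sum_univ_castSucc, Fin.sum_univ_castSucc, hc1, hc2] at this
        rw [← this, ← Equiv.sum_comp αe]
        simp only [hcol P hP, Equiv.symm_apply_apply]
        rfl) (not_le.mp hlt)
    apply hne
    funext j
    refine Fin.lastCases e3 (fun j => ?_) j
    refine Fin.lastCases e2 (fun j => ?_) j
    have := congrFun e1 (αe j)
    simpa using this
  have hcount := rl_nmds_count (by omega) G₃ h1 h2 (by omega)
  have hinj : Function.Injective G₃.vecMulLinear := by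
    rw [← LinearMap.ker_eq_bot, LinearMap.ker_eq_bot']
    intro x hx
    by_contra hne
    have := h1 x hne
    rw [← Matrix.vecMulLinear_apply, hx, hammingNorm_zero] at this
    omega
  have hex : ∃ c : Fin (q + 2) → F, (∃ x : Fin k → F, c = Matrix.vecMul x G₃) ∧
        c ≠ 0 ∧ hammingNorm c = q + 2 - k := by
    obtain ⟨P, hP0, hP, hle⟩ := rl_exists k hk3 hcond a ha
    rw [← hnormP P hP, hF] at hle
    have hx : (fun i : Fin k => P.coeff i) ≠ 0 := by
      intro h
      apply hP0
      ext i
      by_cases hi : i < k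
      · simpa using congrFun h ⟨i, hi⟩
      · rw [Polynomial.coeff_eq_zero_of_natDegree_lt (by omega), Polynomial.coeff_zero]
    have hge := h1 _ hx
    have heq := le_antisymm hle hge
    refine ⟨_, ⟨_, rfl⟩, ?_, heq⟩
    intro h
    rw [h, hammingNorm_zero] at heq
    omega
  simp only [hdual]
  refine ⟨?_, ⟨hex, ?_⟩, ⟨?_, h2⟩, hcount⟩
  · rw [LinearMap.finrank_range_of_inj hinj, Module.finrank_fintype_fun_eq_card, Fintype.card_fin]
  · rintro c ⟨x, rfl⟩ hc
    apply h1
    rintro rfl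
    apply hc
    simp
  · obtain ⟨c, hc, -, hw⟩ := hex
    have hpos : 0 < {c : Fin (q + 2) → F | (∃ x : Fin k → F, c = Matrix.vecMul x G₃) ∧
        hammingNorm c = q + 2 - k}.ncard := (Set.ncard_pos (Set.toFinite _)).mpr ⟨c, hc, hw⟩
    rw [hcount, Set.ncard_pos (Set.toFinite _)] at hpos
    obtain ⟨c, hc, hw⟩ := hpos
    refine ⟨c, hc, ?_, hw⟩
    rintro rfl
    rw [hammingNorm_zero] at hw
    omega
end

section
/- Suppose p = 2, q = 2^m ≥ 4, k = 3, and M = M_0 is the 2×2 matrix with a_{11} = a_{22} = 0 and a_{12} = a_{21} = 1. Then RL_3(F_q, M_0) is an MDS code with parameters [q+2, 3, q] over F_q: it has dimension 3 and minimum distance q. Equivalently, every 3 columns of the 3×(q+2) matrix G_3 with columns (1, α_j, α_j^2)^T for 1 ≤ j ≤ q, (0, 0, 1)^T, and (0, 1, 0)^T are linearly independent over F_q. -/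
/-- for p = 2, q = 2^m ≥ 4 and k = 3, the code RL₃(F_q, M₀) with
M₀ = [[0,1],[1,0]] is MDS with parameters [q+2, 3, q]: it has dimension 3 and
minimum distance q; equivalently every 3 columns of G₃ are linearly independent. -/
theorem stmt14 (m q : ℕ) (hq : q = 2 ^ m) (hq4 : 4 ≤ q)
    (F : Type*) [Field F] [Fintype F] [DecidableEq F] (hF : Fintype.card F = q)
    (α : Fin q → F) (hα : Function.Bijective α)
    (G₃ : Matrix (Fin 3) (Fin (q + 2)) F)
    (hGv : ∀ (i : Fin 3) (j : Fin (q + 2)) (h : (j : ℕ) < q),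
      G₃ i j = α ⟨j, h⟩ ^ (i : ℕ))
    (hGc1 : ∀ (i : Fin 3) (j : Fin (q + 2)), (j : ℕ) = q →
      G₃ i j = if (i : ℕ) = 2 then 1 else 0)
    (hGc2 : ∀ (i : Fin 3) (j : Fin (q + 2)), (j : ℕ) = q + 1 →
      G₃ i j = if (i : ℕ) = 1 then 1 else 0) :
    -- the code has dimension 3
    Module.finrank F (LinearMap.range G₃.vecMulLinear) = 3 ∧
    -- the minimum distance of the code is q
    ((∃ c : Fin (q + 2) → F, (∃ x : Fin 3 → F, c = Matrix.vecMul x G₃) ∧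
        c ≠ 0 ∧ hammingNorm c = q) ∧
      (∀ c : Fin (q + 2) → F, (∃ x : Fin 3 → F, c = Matrix.vecMul x G₃) →
        c ≠ 0 → q ≤ hammingNorm c)) ∧
    -- every 3 columns of G₃ are linearly independent
    (∀ s : Finset (Fin (q + 2)), s.card = 3 →
      LinearIndependent F (fun j : s => fun i : Fin 3 => G₃ i j)) := by
  have h2 : (2 : F) = 0 := by
    have h : ((Fintype.card F : ℕ) : F) = 0 := Nat.cast_card_eq_zero F
    rw [hF, hq] at h
    push_cast at h
    exact eq_zero_of_pow_eq_zero h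
  have ev : ∀ (x : Fin 3 → F) (j : Fin (q + 2)),
      Matrix.vecMul x G₃ j = x 0 * G₃ 0 j + x 1 * G₃ 1 j + x 2 * G₃ 2 j := by
    intro x j
    simp [Matrix.vecMul, dotProduct, Fin.sum_univ_three]
  have evA : ∀ (x : Fin 3 → F) (j : Fin (q + 2)) (h : (j : ℕ) < q),
      Matrix.vecMul x G₃ j = x 0 + x 1 * α ⟨j, h⟩ + x 2 * α ⟨j, h⟩ ^ 2 := by
    intro x j h
    rw [ev, hGv 0 j h, hGv 1 j h, hGv 2 j h]
    simp
  have evB : ∀ (x : Fin 3 → F) (j : Fin (q + 2)), (j : ℕ) = q →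
      Matrix.vecMul x G₃ j = x 2 := by
    intro x j h
    rw [ev, hGc1 0 j h, hGc1 1 j h, hGc1 2 j h]
    simp
  have evC : ∀ (x : Fin 3 → F) (j : Fin (q + 2)), (j : ℕ) = q + 1 →
      Matrix.vecMul x G₃ j = x 1 := by
    intro x j h
    rw [ev, hGc2 0 j h, hGc2 1 j h, hGc2 2 j h]
    simp
  have fin0 : ∀ (x : Fin 3 → F) (t : F), x 1 = 0 → x 2 = 0 →
      x 0 + x 1 * t + x 2 * t ^ 2 = 0 → x = 0 := by
    intro x t h1 h2' h
    rw [h1, h2'] at h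
    have h0 : x 0 = 0 := by simpa using h
    funext i
    fin_cases i <;> simp [h0, h1, h2']
  have K1 : ∀ (x : Fin 3 → F) (a b c : Fin (q + 2)), a < b → b < c →
      Matrix.vecMul x G₃ a = 0 → Matrix.vecMul x G₃ b = 0 → Matrix.vecMul x G₃ c = 0 →
      x = 0 := by
    intro x a b c hab hbc ha hb hc
    have hab' : (a : ℕ) < b := hab
    have hbc' : (b : ℕ) < c := hbc
    have hcl := c.isLt
    have haq : (a : ℕ) < q := by omega
    rw [evA x a haq] at ha
    by_cases hbq : (b : ℕ) < q
    · rw [evA x b hbq] at hb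
      have nab : α ⟨a, haq⟩ - α ⟨b, hbq⟩ ≠ 0 := by
        intro h
        have := hα.1 (sub_eq_zero.1 h)
        simp at this
        omega
      have e1 : x 1 + x 2 * (α ⟨a, haq⟩ + α ⟨b, hbq⟩) = 0 := by
        apply (mul_eq_zero.1 (_ : (α ⟨a, haq⟩ - α ⟨b, hbq⟩) * _ = 0)).resolve_left nab
        linear_combination ha - hb
      by_cases hcq : (c : ℕ) < q
      · rw [evA x c hcq] at hc
        have nac : α ⟨a, haq⟩ - α ⟨c, hcq⟩ ≠ 0 := by
          intro h
          have := hα.1 (sub_eq_zero.1 h)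
          simp at this
          omega
        have nbc : α ⟨b, hbq⟩ - α ⟨c, hcq⟩ ≠ 0 := by
          intro h
          have := hα.1 (sub_eq_zero.1 h)
          simp at this
          omega
        have e2 : x 1 + x 2 * (α ⟨a, haq⟩ + α ⟨c, hcq⟩) = 0 := by
          apply (mul_eq_zero.1 (_ : (α ⟨a, haq⟩ - α ⟨c, hcq⟩) * _ = 0)).resolve_left nac
          linear_combination ha - hc
        have e3 : x 2 = 0 := by
          apply (mul_eq_zero.1 (_ : (α ⟨b, hbq⟩ - α ⟨c, hcq⟩) * _ = 0)).resolve_left nbc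
          linear_combination e1 - e2
        have e4 : x 1 = 0 := by simpa [e3] using e1
        exact fin0 x _ e4 e3 ha
      · by_cases hcq' : (c : ℕ) = q
        · rw [evB x c hcq'] at hc
          have e4 : x 1 = 0 := by simpa [hc] using e1
          exact fin0 x _ e4 hc ha
        · rw [evC x c (by omega)] at hc
          have e3 : x 2 = 0 := by
            apply (mul_eq_zero.1 (_ : (α ⟨a, haq⟩ - α ⟨b, hbq⟩) * _ = 0)).resolve_left nab
            linear_combination e1 - hc - x 2 * α ⟨b, hbq⟩ * h2
          exact fin0 x _ hc e3 ha
    · rw [evB x b (by omega)] at hb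
      rw [evC x c (by omega)] at hc
      exact fin0 x _ hc hb ha
  have K : ∀ (x : Fin 3 → F) (s : Finset (Fin (q + 2))), s.card = 3 →
      (∀ j ∈ s, Matrix.vecMul x G₃ j = 0) → x = 0 := by
    intro x s hs h
    let e := s.orderEmbOfFin hs
    exact K1 x (e 0) (e 1) (e 2) (e.strictMono (by decide)) (e.strictMono (by decide))
      (h _ (s.orderEmbOfFin_mem hs 0)) (h _ (s.orderEmbOfFin_mem hs 1))
      (h _ (s.orderEmbOfFin_mem hs 2))
  have lower : ∀ c : Fin (q + 2) → F, (∃ x : Fin 3 → F, c = Matrix.vecMul x G₃) →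
        c ≠ 0 → q ≤ hammingNorm c := by
    rintro c ⟨x, rfl⟩ hc
    by_contra hlt
    have hsum := Finset.card_filter_add_card_filter_not (s := (Finset.univ : Finset (Fin (q + 2))))
      (fun j => Matrix.vecMul x G₃ j ≠ 0)
    rw [Finset.card_univ, Fintype.card_fin] at hsum
    unfold hammingNorm at hlt
    obtain ⟨s, hs, hs3⟩ := Finset.exists_subset_card_eq (n := 3)
      (s := Finset.univ.filter (fun j => ¬ (Matrix.vecMul x G₃ j ≠ 0))) (by omega)
    apply hc
    rw [K x s hs3 (fun j hj => by simpa using hs hj)]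
    simp
  refine ⟨?_, ⟨?_, lower⟩, ?_⟩
  · rw [LinearMap.finrank_range_of_inj]
    · simp
    · rw [injective_iff_map_eq_zero]
      intro x hx
      have hx' : Matrix.vecMul x G₃ = 0 := hx
      obtain ⟨s, -, hs3⟩ := Finset.exists_subset_card_eq (n := 3)
        (s := (Finset.univ : Finset (Fin (q + 2)))) (by simp; omega)
      exact K x s hs3 (fun j _ => by rw [hx']; rfl)
  · have hne : Matrix.vecMul (![0, 0, 1] : Fin 3 → F) G₃ ≠ 0 := by
      intro h
      have := evB ![0, 0, 1] ⟨q, by omega⟩ rfl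
      rw [h] at this
      simp at this
    refine ⟨_, ⟨![0, 0, 1], rfl⟩, hne, le_antisymm ?_ (lower _ ⟨_, rfl⟩ hne)⟩
    have hsum := Finset.card_filter_add_card_filter_not (s := (Finset.univ : Finset (Fin (q + 2))))
      (fun j => Matrix.vecMul (![0, 0, 1] : Fin 3 → F) G₃ j ≠ 0)
    rw [Finset.card_univ, Fintype.card_fin] at hsum
    unfold hammingNorm
    obtain ⟨z, hz⟩ := hα.2 0
    have hzl := z.isLt
    have : 1 < (Finset.univ.filter
        (fun j => ¬ (Matrix.vecMul (![0, 0, 1] : Fin 3 → F) G₃ j ≠ 0))).card := by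
      rw [Finset.one_lt_card]
      refine ⟨⟨z, by omega⟩, ?_, ⟨q + 1, by omega⟩, ?_, ?_⟩
      · simp only [Finset.mem_filter, Finset.mem_univ, true_and, not_not]
        rw [evA _ _ hzl]
        simp [hz]
      · simp only [Finset.mem_filter, Finset.mem_univ, true_and, not_not]
        rw [evC _ _ rfl]
        simp
      · intro h
        simp at h
        omega
    omega
  · intro s hs
    let e : Fin 3 ≃ s := (s.orderIsoOfFin hs).toEquiv
    rw [← linearIndependent_equiv e]
    let B : Matrix (Fin 3) (Fin 3) F := fun i l => G₃ l (e i)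
    change LinearIndependent F B.row
    rw [Matrix.linearIndependent_rows_iff_isUnit, ← Matrix.mulVec_injective_iff_isUnit]
    change Function.Injective B.mulVecLin
    rw [injective_iff_map_eq_zero]
    intro x hx
    apply K x s hs
    intro j hj
    have h : ∑ l, G₃ l (e (e.symm ⟨j, hj⟩)) * x l = 0 := congrFun hx (e.symm ⟨j, hj⟩)
    rw [Equiv.apply_symm_apply, Fin.sum_univ_three] at h
    rw [ev]
    linear_combination h
end

section
/- Suppose p = 2, q = 2^m ≥ 4, k = q−1, and M = M_0 is the 2×2 matrix with a_{11} = a_{22} = 0 and a_{12} = a_{21} = 1. Then RL_{q−1}(F_q, M_0) is an MDS code with parameters [q+2, q−1, 4] over F_q: it has dimension q−1 and minimum distance 4. Equivalently, every q−1 columns of the (q−1)×(q+2) matrix G_3 (whose j-th column is (1, α_j, …, α_j^{q−2})^T for 1 ≤ j ≤ q, whose (q+1)-th column is (0, …, 0, 0, 1)^T, and whose (q+2)-th column is (0, …, 0, 1, 0)^T) are linearly independent over F_q. -/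
open Polynomial in
theorem aux_poly {F : Type*} [Field F] [Fintype F] [DecidableEq F] (q m : ℕ) (hq : q = 2 ^ m)
    (hq4 : 4 ≤ q) (hF : Fintype.card F = q) (f : F[X]) (hf : f ≠ 0) (hd : f.natDegree < q - 1) :
    (∑ a : F, if f.eval a = 0 then 1 else 0) + (if f.coeff (q - 2) = 0 then 1 else 0)
      + (if f.coeff (q - 3) = 0 then 1 else 0) ≤ q - 2 := by
  have hc : (∑ a : F, if f.eval a = 0 then 1 else 0) = f.roots.toFinset.card := by
    rw [← Finset.card_filter]
    congr 1
    ext a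
    simp [hf]
  rw [hc]
  have h1 : f.roots.toFinset.card ≤ f.roots.card := Multiset.toFinset_card_le _
  have h2 : f.roots.card ≤ f.natDegree := f.card_roots'
  by_cases c2 : f.coeff (q - 2) = 0
  · have h3 : f.natDegree ≠ q - 2 := by
      intro h
      rw [← h] at c2
      exact hf (leadingCoeff_eq_zero.mp c2)
    by_cases c3 : f.coeff (q - 3) = 0
    · have h4 : f.natDegree ≠ q - 3 := by
        intro h
        rw [← h] at c3
        exact hf (leadingCoeff_eq_zero.mp c3)
      simp only [c2, c3, if_true]
      omega
    · simp only [c2, c3, if_true, if_false]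
      omega
  · have h3 : f.natDegree = q - 2 := by
      have := le_natDegree_of_ne_zero c2
      omega
    by_cases c3 : f.coeff (q - 3) = 0
    · simp only [c2, c3, if_true, if_false]
      by_contra hcon
      have h5 : f.roots.toFinset.card = q - 2 := by omega
      have h6 : f.roots.card = f.natDegree := by omega
      have hs : f.Splits := splits_iff_card_roots.mpr h6
      have hn := hs.nextCoeff_eq_neg_sum_roots_mul_leadingCoeff
      have hnod : f.roots.Nodup := by
        rw [← Multiset.toFinset_card_eq_card_iff_nodup]; omega
      have hsum : f.roots.sum = 0 := by
        rw [nextCoeff_of_natDegree_pos (by omega), h3, show q - 2 - 1 = q - 3 by omega, c3] at hn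
        have hl : f.leadingCoeff ≠ 0 := leadingCoeff_ne_zero.mpr hf
        simpa [hl] using hn.symm
      have hsum' : ∑ a ∈ f.roots.toFinset, a = 0 := by
        rw [← hsum, Finset.sum_eq_multiset_sum, Multiset.toFinset_val, hnod.dedup, Multiset.map_id']
      have hall : ∑ a : F, a = 0 := by
        have := FiniteField.sum_pow_lt_card_sub_one F 1 (by omega)
        simpa using this
      have hcc : (f.roots.toFinsetᶜ).card = 2 := by
        rw [Finset.card_compl]; omega
      obtain ⟨a, b, hab, he⟩ := Finset.card_eq_two.mp hcc
      rw [← Finset.sum_add_sum_compl f.roots.toFinset, hsum', he, Finset.sum_pair hab, zero_add] at hall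
      have h20 : (2 : F) = 0 := by
        have h := FiniteField.cast_card_eq_zero F
        rw [hF, hq] at h
        push_cast at h
        have hm : m ≠ 0 := by
          rintro rfl
          simp at hq
          omega
        exact (pow_eq_zero_iff hm).mp h
      apply hab
      linear_combination hall - b * h20
    · simp only [c2, c3, if_false]
      omega

/-- for p = 2, q = 2^m ≥ 4 and k = q - 1, the code RL_{q-1}(F_q, M₀)
with M₀ = [[0,1],[1,0]] is MDS with parameters [q+2, q-1, 4]: it has dimension q-1
and minimum distance 4; equivalently every q-1 columns of G₃ are linearly
independent. -/
theorem stmt15 (m q : ℕ) (hq : q = 2 ^ m) (hq4 : 4 ≤ q)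
    (F : Type*) [Field F] [Fintype F] [DecidableEq F] (hF : Fintype.card F = q)
    (α : Fin q → F) (hα : Function.Bijective α)
    (G₃ : Matrix (Fin (q - 1)) (Fin (q + 2)) F)
    (hGv : ∀ (i : Fin (q - 1)) (j : Fin (q + 2)) (h : (j : ℕ) < q),
      G₃ i j = α ⟨j, h⟩ ^ (i : ℕ))
    (hGc1 : ∀ (i : Fin (q - 1)) (j : Fin (q + 2)), (j : ℕ) = q →
      G₃ i j = if (i : ℕ) = q - 2 then 1 else 0)
    (hGc2 : ∀ (i : Fin (q - 1)) (j : Fin (q + 2)), (j : ℕ) = q + 1 →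
      G₃ i j = if (i : ℕ) = q - 3 then 1 else 0) :
    -- the code has dimension q - 1
    Module.finrank F (LinearMap.range G₃.vecMulLinear) = q - 1 ∧
    -- the minimum distance of the code is 4
    ((∃ c : Fin (q + 2) → F, (∃ x : Fin (q - 1) → F, c = Matrix.vecMul x G₃) ∧
        c ≠ 0 ∧ hammingNorm c = 4) ∧
      (∀ c : Fin (q + 2) → F, (∃ x : Fin (q - 1) → F, c = Matrix.vecMul x G₃) →
        c ≠ 0 → 4 ≤ hammingNorm c)) ∧
    -- every q - 1 columns of G₃ are linearly independent
    (∀ s : Finset (Fin (q + 2)), s.card = q - 1 →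
      LinearIndependent F (fun j : s => fun i : Fin (q - 1) => G₃ i j)) := by
  obtain ⟨n, rfl⟩ : ∃ n, q = n + 4 := ⟨q - 4, by omega⟩
  have core : ∀ x : Fin (n + 4 - 1) → F, x ≠ 0 →
      (Finset.univ.filter (fun j => Matrix.vecMul x G₃ j = 0)).card ≤ n + 4 - 2 := by
    intro x hx
    let f : Polynomial F := ∑ i : Fin (n + 4 - 1), Polynomial.C (x i) * Polynomial.X ^ (i : ℕ)
    have hcoef : ∀ i : Fin (n + 4 - 1), f.coeff i = x i := by
      intro i
      simp only [f, Polynomial.finsetSum_coeff, Polynomial.coeff_C_mul_X_pow]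
      simp [Fin.val_inj]
    have hf : f ≠ 0 := by
      intro h
      apply hx
      funext i
      rw [← hcoef i, h]
      simp
    have hd : f.natDegree < n + 4 - 1 := by
      have : f.natDegree ≤ n + 4 - 2 := by
        apply Polynomial.natDegree_sum_le_of_forall_le
        intro i _
        refine (Polynomial.natDegree_C_mul_X_pow_le _ _).trans ?_
        omega
      omega
    have key := aux_poly (n + 4) m hq hq4 hF f hf hd
    rw [Finset.card_filter, Fin.sum_univ_castSucc, Fin.sum_univ_castSucc]
    have e1 : ∀ j : Fin (n + 4), Matrix.vecMul x G₃ j.castSucc.castSucc = f.eval (α j) := by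
      intro j
      simp only [Matrix.vecMul, dotProduct, f, Polynomial.eval_finsetSum]
      refine Finset.sum_congr rfl fun i _ => ?_
      rw [hGv i _ (by simp)]
      simp
    have e2 : Matrix.vecMul x G₃ (Fin.last (n + 4)).castSucc = f.coeff (n + 4 - 2) := by
      rw [show n + 4 - 2 = ((⟨n + 4 - 2, by omega⟩ : Fin (n + 4 - 1)) : ℕ) from rfl, hcoef]
      simp only [Matrix.vecMul, dotProduct]
      rw [Finset.sum_eq_single ⟨n + 4 - 2, by omega⟩]
      · rw [hGc1 _ _ (by simp)]; simp
      · intro i _ hi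
        rw [hGc1 _ _ (by simp), if_neg (fun h => hi (Fin.ext h)), mul_zero]
      · simp
    have e3 : Matrix.vecMul x G₃ (Fin.last (n + 4 + 1)) = f.coeff (n + 4 - 3) := by
      rw [show n + 4 - 3 = ((⟨n + 4 - 3, by omega⟩ : Fin (n + 4 - 1)) : ℕ) from rfl, hcoef]
      simp only [Matrix.vecMul, dotProduct]
      rw [Finset.sum_eq_single ⟨n + 4 - 3, by omega⟩]
      · rw [hGc2 _ _ (by simp)]; simp
      · intro i _ hi
        rw [hGc2 _ _ (by simp), if_neg (fun h => hi (Fin.ext h)), mul_zero]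
      · simp
    simp only [e1, e2, e3]
    rw [hα.sum_comp (fun a => if f.eval a = 0 then 1 else 0)]
    exact key
  have hw : ∀ c : Fin (n + 4 + 2) → F,
      (Finset.univ.filter (fun j => c j = 0)).card + hammingNorm c = n + 4 + 2 := by
    intro c
    have := Finset.card_filter_add_card_filter_not (s := (Finset.univ : Finset (Fin (n + 4 + 2))))
      (fun j => c j = 0)
    simpa [hammingNorm] using this
  have hmin : ∀ x : Fin (n + 4 - 1) → F, x ≠ 0 → 4 ≤ hammingNorm (Matrix.vecMul x G₃) := by
    intro x hx
    have := core x hx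
    have := hw (Matrix.vecMul x G₃)
    omega
  refine ⟨?_, ⟨?_, ?_⟩, ?_⟩
  · rw [LinearMap.finrank_range_of_inj]
    · simp
    · rw [injective_iff_map_eq_zero]
      intro x hx
      by_contra h
      have := hmin x h
      rw [Matrix.vecMulLinear_apply] at hx
      rw [hx] at this
      simp at this
  · let L : (Fin (n + 4 - 1) → F) →ₗ[F] (Fin (n + 2) → F) :=
      (LinearMap.funLeft F F (Fin.castLE (by omega : n + 2 ≤ n + 4 + 2))) ∘ₗ G₃.vecMulLinear
    have hk : LinearMap.ker L ≠ ⊥ := LinearMap.ker_ne_bot_of_finrank_lt (by simp)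
    obtain ⟨x, hx, hx0⟩ := Submodule.exists_mem_ne_zero_of_ne_bot hk
    have h4 := hmin x hx0
    refine ⟨Matrix.vecMul x G₃, ⟨x, rfl⟩, ?_, ?_⟩
    · intro h
      rw [h] at h4
      simp at h4
    · have hz : n + 2 ≤ (Finset.univ.filter (fun j => Matrix.vecMul x G₃ j = 0)).card := by
        have : (Finset.univ.map (Fin.castLEEmb (by omega : n + 2 ≤ n + 4 + 2))).card = n + 2 := by simp
        rw [← this]
        apply Finset.card_le_card
        intro j hj
        obtain ⟨i, _, rfl⟩ := Finset.mem_map.mp hj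
        simp only [Finset.mem_filter, Finset.mem_univ, true_and]
        exact congrFun (LinearMap.mem_ker.mp hx) i
      have := hw (Matrix.vecMul x G₃)
      omega
  · rintro c ⟨x, rfl⟩ hc
    apply hmin
    rintro rfl
    simp at hc
  · intro s hs
    let e : Fin (n + 4 - 1) ≃ s := (s.equivFinOfCardEq hs).symm
    let A : Matrix (Fin (n + 4 - 1)) (Fin (n + 4 - 1)) F := G₃.submatrix id (fun j => (e j : Fin (n + 4 + 2)))
    have hinj : Function.Injective A.vecMul := by
      have : Function.Injective A.vecMulLinear := by
        rw [injective_iff_map_eq_zero]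
        intro x hx
        by_contra h
        have h1 := core x h
        have h2 : s.card ≤ (Finset.univ.filter (fun j => Matrix.vecMul x G₃ j = 0)).card := by
          apply Finset.card_le_card
          intro j hj
          simp only [Finset.mem_filter, Finset.mem_univ, true_and]
          have := congrFun hx (e.symm ⟨j, hj⟩)
          simpa [A, Matrix.vecMul, dotProduct] using this
        omega
      exact this
    have hU : IsUnit A := Matrix.vecMul_injective_iff_isUnit.mp hinj
    have hl : LinearIndependent F A.col := Matrix.linearIndependent_cols_iff_isUnit.mpr hU
    rw [← linearIndependent_equiv e]
    exact hl
end
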